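/- Let t = 2t' be an even positive integer and b a complex number. Then Σ_{λ ∈ SC} δ_λ x^{|λ|} ∏_{h ∈ H_t(λ)} bt/(h ε_h) = exp(-b² t' x^{2t}) · ∏_{k≥1} [(1-x^k)/(1-x^{2k})] · (1-x^{2kt})^{t'}, as formal power series in x over ℂ, where the sum ranges over all self-conjugate partitions. -/

import Mathlib

/-!
Statement 15 (Corollary `funexppair`, even case): for `t = 2t'` an even positive
integer and a complex number `b`,
Σ_{λ ∈ SC} δ_λ x^{|λ|} ∏_{h ∈ H_t(λ)} bt/(h ε_h)
  = exp(-b² t' x^{2t}) · ∏_{k≥1} [(1-x^k)/(1-x^{2k})] · (1-x^{2kt})^{t'},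
as formal power series over ℂ, the sum ranging over self-conjugate partitions.
-/

noncomputable section

open PowerSeries

/-- Product (pi) topology on formal power series. -/
instance {R : Type*} [TopologicalSpace R] : TopologicalSpace (PowerSeries R) :=
  inferInstanceAs (TopologicalSpace ((Unit →₀ ℕ) → R))

/-- The hook length of the box `c = (i, j)` (0-indexed) of a Young diagram. -/
def hookLen (μ : YoungDiagram) (c : ℕ × ℕ) : ℕ :=
  μ.rowLen c.1 + μ.colLen c.2 - c.1 - c.2 - 1

/-- The Durfee length: the number of diagonal cells. -/
def durfee (μ : YoungDiagram) : ℕ :=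
  (μ.cells.filter fun c => c.1 = c.2).card

/-- `ε` of a box: `-1` if strictly above the principal diagonal, `1` otherwise. -/
def eps (c : ℕ × ℕ) : ℂ := if c.2 < c.1 then (-1 : ℂ) else 1

/-- The formal exponential `exp f = Σ_k f^k / k!` of a power series. -/
def pexp (f : PowerSeries ℂ) : PowerSeries ℂ :=
  ∑' k : ℕ, PowerSeries.C (R := ℂ) ((k.factorial : ℂ))⁻¹ * f ^ k

theorem sum_det_updateRow {m : ℕ} (A B : Matrix (Fin m) (Fin m) ℂ) :
    ∑ i, (A.updateRow i ((A * B) i)).det = B.trace * A.det := by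
  have h : ∀ i, (A.updateRow i ((A * B) i)).det = (A * B * A.adjugate) i i := by
    intro i
    rw [← Matrix.cramer_transpose_apply, Matrix.cramer_eq_adjugate_mulVec, Matrix.mul_apply,
      ← Matrix.adjugate_transpose]
    simp [Matrix.mulVec, dotProduct, mul_comm]
  simp_rw [h]
  change Matrix.trace _ = _
  rw [Matrix.mul_assoc, Matrix.trace_mul_comm, Matrix.mul_assoc, Matrix.adjugate_mul]
  simp [mul_comm]

/-- falling factorial matrix -/
def ffM {m : ℕ} (x : Fin m → ℕ) : Matrix (Fin m) (Fin m) ℂ :=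
  Matrix.of fun i j => ((x i).descFactorial j : ℂ)

/-- reciprocal hook product -/
def FF {m : ℕ} (x : Fin m → ℕ) : ℂ := (ffM x).det / ∏ i, ((x i).factorial : ℂ)

theorem FF_lower {m : ℕ} (x : Fin m → ℕ) :
    ∑ i, (if x i = 0 then 0 else FF (Function.update x i (x i - 1))) =
      ((∑ i, (x i : ℂ)) - ∑ j : Fin m, (j : ℂ)) * FF x := by
  have h1 : ∀ i, (if x i = 0 then 0 else FF (Function.update x i (x i - 1))) =
      ((x i : ℂ) * (ffM x).det -
        ((ffM x).updateRow i ((ffM x * Matrix.diagonal fun j : Fin m => (j : ℂ)) i)).det)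
        / ∏ i, ((x i).factorial : ℂ) := by
    intro i
    have h2 : (x i : ℂ) * (ffM x).det -
        ((ffM x).updateRow i ((ffM x * Matrix.diagonal fun j : Fin m => (j : ℂ)) i)).det
        = (x i : ℂ) * (ffM (Function.update x i (x i - 1))).det := by
      have e1 : (x i : ℂ) * (ffM x).det = ((ffM x).updateRow i ((x i : ℂ) • (ffM x) i)).det := by
        rw [Matrix.det_updateRow_smul, Matrix.updateRow_eq_self]
      have e2 : ffM (Function.update x i (x i - 1)) = (ffM x).updateRow i
          (fun j => ((x i - 1).descFactorial j : ℂ)) := by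
        ext a j
        by_cases h : a = i
        · subst h; simp [ffM]
        · simp [ffM, h]
      rw [e1, e2, ← Matrix.det_updateRow_smul, sub_eq_iff_eq_add, ← Matrix.det_updateRow_add]
      congr 2
      ext j
      simp only [ffM, Pi.smul_apply, Matrix.of_apply, smul_eq_mul, Pi.add_apply,
        Matrix.mul_diagonal]
      rcases Nat.eq_zero_or_pos (x i) with h0 | h0
      · rw [h0]
        rcases Nat.eq_zero_or_pos (j : ℕ) with h3 | h3
        · simp [h3]
        · rw [Nat.descFactorial_of_lt (by omega : 0 < (j : ℕ))]; simp
      · obtain ⟨k, hk⟩ : ∃ k, x i = k + 1 := ⟨x i - 1, by omega⟩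
        rw [hk]
        have := Nat.succ_descFactorial_succ k j
        have h5 := Nat.descFactorial_succ (k + 1) j
        rw [this] at h5
        simp only [Nat.add_sub_cancel]
        by_cases h6 : (j : ℕ) ≤ k + 1
        · zify [h6] at h5
          have h7 := congrArg (Int.cast : ℤ → ℂ) h5
          push_cast at h7 ⊢
          rw [h7]; ring
        · rw [Nat.descFactorial_of_lt (by omega), Nat.descFactorial_of_lt (by omega)]; simp
    rw [h2]
    split_ifs with h
    · simp [h]
    · unfold FF
      have h8 : ∏ a, ((x a).factorial : ℂ) =
          (x i : ℂ) * ∏ a, ((Function.update x i (x i - 1) a).factorial : ℂ) := by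
        rw [← Finset.mul_prod_erase _ _ (Finset.mem_univ i),
          ← Finset.mul_prod_erase _ (fun a => ((Function.update x i (x i - 1) a).factorial : ℂ))
            (Finset.mem_univ i), ← mul_assoc]
        congr 1
        · simp only [Function.update_self]
          rw [← Nat.mul_factorial_pred h]; push_cast; rfl
        · apply Finset.prod_congr rfl
          intro a ha
          rw [Function.update_of_ne (Finset.ne_of_mem_erase ha)]
      rw [h8, mul_div_mul_left]
      exact_mod_cast h
  simp_rw [h1]
  rw [← Finset.sum_div, Finset.sum_sub_distrib, sum_det_updateRow, Matrix.trace_diagonal,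
    ← Finset.sum_mul, ← sub_mul, FF, mul_div_assoc]

theorem FF_raise {m : ℕ} (x : Fin m → ℕ) (i0 : Fin m) (h0 : x i0 = 0) :
    ∑ i, FF (Function.update x i (x i + 1)) = FF x := by
  have : NeZero m := ⟨by have := i0.2; omega⟩
  let S : Matrix (Fin m) (Fin m) ℂ := Matrix.of fun k j => if (k : ℕ) + 1 = j then 1 else 0
  have hS : S.trace = 0 := by simp [S, Matrix.trace]
  let u : Fin m → ℂ := fun i => ((x i : ℂ) + 1)⁻¹
  have h1 : ∀ i, FF (Function.update x i (x i + 1)) =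
      (((ffM x).updateRow i ((ffM x * S) i)).det + u i * (ffM x).adjugate 0 i)
        / ∏ i, ((x i).factorial : ℂ) := by
    intro i
    have hne : (x i : ℂ) + 1 ≠ 0 := by exact_mod_cast Nat.succ_ne_zero (x i)
    have h2 : ((ffM x).updateRow i ((ffM x * S) i)).det + u i * (ffM x).adjugate 0 i
        = u i * (ffM (Function.update x i (x i + 1))).det := by
      have e2 : ffM (Function.update x i (x i + 1)) = (ffM x).updateRow i
          (fun j => ((x i + 1).descFactorial j : ℂ)) := by
        ext a j
        by_cases h : a = i
        · subst h; simp [ffM]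
        · simp [ffM, h]
      rw [e2, Matrix.adjugate_apply, ← Matrix.det_updateRow_smul, ← Matrix.det_updateRow_smul,
        ← Matrix.det_updateRow_add]
      congr 2
      ext j
      simp only [ffM, Pi.smul_apply, Matrix.of_apply, smul_eq_mul, Pi.add_apply, Matrix.mul_apply,
        S, u]
      rcases j with ⟨j, hj⟩
      rcases j with _ | j
      · simp
      · rw [Finset.sum_eq_single (⟨j, by omega⟩ : Fin m)]
        · simp only [if_true, mul_one, Nat.succ_descFactorial_succ]
          push_cast
          rw [inv_mul_cancel_left₀ hne]
          simp [Pi.single_apply, Fin.ext_iff]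
        · intro b _ hb
          rw [if_neg]
          · simp
          · intro h; apply hb; ext; simp at h; simpa using h
        · simp
    rw [h2]
    unfold FF
    have h8 : ∏ a, ((Function.update x i (x i + 1) a).factorial : ℂ) =
          ((x i : ℂ) + 1) * ∏ a, ((x a).factorial : ℂ) := by
      rw [← Finset.mul_prod_erase _ _ (Finset.mem_univ i),
          ← Finset.mul_prod_erase _ (fun a => ((x a).factorial : ℂ))
            (Finset.mem_univ i), ← mul_assoc]
      congr 1
      · simp only [Function.update_self]
        rw [Nat.factorial_succ]; push_cast; rfl
      · apply Finset.prod_congr rfl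
        intro a ha
        rw [Function.update_of_ne (Finset.ne_of_mem_erase ha)]
    rw [h8]
    simp only [u]
    field_simp
  simp_rw [h1]
  rw [← Finset.sum_div, Finset.sum_add_distrib, sum_det_updateRow, hS, zero_mul, zero_add, FF]
  congr 1
  have h3 : ∑ i, u i * (ffM x).adjugate 0 i = ((ffM x).updateCol 0 u).det := by
    rw [← Matrix.cramer_apply, Matrix.cramer_eq_adjugate_mulVec]
    simp [Matrix.mulVec, dotProduct, mul_comm]
  rw [h3]
  have h4 : (ffM x).updateCol 0 u = (ffM x).updateCol 0 ((fun i => u i - 1) + (fun i => ffM x i 0)) := by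
    congr 1; ext i; simp [ffM]
  rw [h4, Matrix.det_updateCol_add, Matrix.updateCol_eq_self]
  rw [Matrix.det_eq_zero_of_row_eq_zero i0, zero_add]
  intro j
  by_cases hj : j = 0
  · subst hj; simp [u, h0]
  · rw [Matrix.updateCol_ne hj]
    have : 0 < (j : ℕ) := Nat.pos_of_ne_zero (fun h => hj (Fin.ext (by simpa using h)))
    simp [ffM, h0, Nat.descFactorial_of_lt this]

theorem FF_eq {m : ℕ} (x : Fin m → ℕ) :
    FF x = (∏ i, ∏ j ∈ Finset.Ioi i, ((x j : ℂ) - x i)) / ∏ i, ((x i).factorial : ℂ) := by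
  unfold FF
  rw [← Matrix.det_vandermonde (fun i => (x i : ℂ)),
    Matrix.det_eval_matrixOfPolynomials_eq_det_vandermonde (fun i => (x i : ℂ))
      (fun i => descPochhammer ℂ i) (fun i => descPochhammer_natDegree ℂ i)
      (fun i => monic_descPochhammer ℂ i)]
  congr 2
  ext i j
  simp [ffM, descPochhammer_eval_eq_descFactorial]

theorem FF_zero_of_not_inj {m : ℕ} (x : Fin m → ℕ) (h : ¬ Function.Injective x) : FF x = 0 := by
  simp only [Function.Injective, not_forall] at h
  obtain ⟨i, j, hij, hne⟩ := h
  unfold FF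
  rw [Matrix.det_zero_of_row_eq hne, zero_div]
  ext k
  simp [ffM, hij]

theorem FF_perm_sq {m : ℕ} (x : Fin m → ℕ) (σ : Equiv.Perm (Fin m)) :
    FF (x ∘ σ) ^ 2 = FF x ^ 2 := by
  unfold FF
  have h1 : ffM (x ∘ σ) = (ffM x).submatrix σ id := by ext i j; simp [ffM]
  rw [h1, Matrix.det_permute]
  have h2 : ∏ i, (((x ∘ σ) i).factorial : ℂ) = ∏ i, ((x i).factorial : ℂ) :=
    Equiv.prod_comp σ (fun i => ((x i).factorial : ℂ))
  rw [h2, div_pow, mul_pow, div_pow]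
  have h3 : (((Equiv.Perm.sign σ : ℤˣ) : ℤ) : ℂ) ^ 2 = 1 := by
    rcases Int.units_eq_one_or (Equiv.Perm.sign σ) with h | h <;> simp [h]
  rw [h3, one_mul]

/-- hook product of a bead set -/
def hkp (X : Finset ℕ) : ℂ := ∏ x ∈ X, ∏ y ∈ (Finset.range x).filter (· ∉ X), ((x : ℂ) - y)

theorem prod_range_sub (x : ℕ) : ∏ y ∈ Finset.range x, ((x : ℂ) - y) = (x.factorial : ℂ) := by
  rw [← Finset.prod_range_reflect, ← Finset.prod_range_add_one_eq_factorial]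
  push_cast
  apply Finset.prod_congr rfl
  intro y hy
  have := Finset.mem_range.1 hy
  rw [Nat.sub_sub, Nat.cast_sub (by omega)]
  push_cast; ring

theorem FF_sorted {m : ℕ} (X : Finset ℕ) (h : X.card = m) :
    FF (X.orderEmbOfFin h) = (hkp X)⁻¹ := by
  rw [FF_eq]
  have hi := (X.orderEmbOfFin h).injective
  have himg : Finset.univ.image (X.orderEmbOfFin h) = X := by simp
  have e1 : ∏ i, ((X.orderEmbOfFin h i).factorial : ℂ) = ∏ x ∈ X, (x.factorial : ℂ) := by
    conv_rhs => rw [← himg]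
    rw [Finset.prod_image (fun a _ b _ hab => hi hab)]
  have e2 : ∏ i, ∏ j ∈ Finset.Ioi i, ((X.orderEmbOfFin h j : ℂ) - X.orderEmbOfFin h i) =
      ∏ x ∈ X, ∏ y ∈ (Finset.range x).filter (· ∈ X), ((x : ℂ) - y) := by
    rw [Finset.prod_comm' (s' := fun j => Finset.Iio j) (t' := Finset.univ) (by simp)]
    conv_rhs => rw [← himg]
    rw [Finset.prod_image (fun a _ b _ hab => hi hab)]
    apply Finset.prod_congr rfl
    intro j _
    have : (Finset.range (X.orderEmbOfFin h j)).filter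
        (· ∈ Finset.univ.image (X.orderEmbOfFin h)) = (Finset.Iio j).image (X.orderEmbOfFin h) := by
      ext y
      simp only [Finset.mem_filter, Finset.mem_range, Finset.mem_image, Finset.mem_univ, true_and,
        Finset.mem_Iio]
      constructor
      · rintro ⟨h1, a, rfl⟩
        exact ⟨a, by simpa using h1, rfl⟩
      · rintro ⟨a, h1, rfl⟩
        exact ⟨by simpa using h1, a, rfl⟩
    rw [this, Finset.prod_image (fun a _ b _ hab => hi hab)]
  rw [e1, e2]
  have e3 : ∏ x ∈ X, (x.factorial : ℂ) =
      (∏ x ∈ X, ∏ y ∈ (Finset.range x).filter (· ∈ X), ((x : ℂ) - y)) * hkp X := by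
    rw [hkp, ← Finset.prod_mul_distrib]
    apply Finset.prod_congr rfl
    intro x _
    rw [Finset.prod_filter_mul_prod_filter_not, prod_range_sub]
  rw [e3, div_mul_eq_div_div, div_self, one_div]
  rw [Finset.prod_ne_zero_iff]
  intro x _
  rw [Finset.prod_ne_zero_iff]
  intro y hy
  simp only [Finset.mem_filter, Finset.mem_range] at hy
  rw [sub_ne_zero]
  exact_mod_cast hy.1.ne'

/-- `m`-subsets of `ℕ` with sum `K` -/
def BB (m K : ℕ) : Finset (Finset ℕ) :=
  ((Finset.range (K + 1)).powersetCard m).filter (fun X => ∑ x ∈ X, x = K)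

theorem mem_BB {m K : ℕ} {X : Finset ℕ} : X ∈ BB m K ↔ X.card = m ∧ ∑ x ∈ X, x = K := by
  simp only [BB, Finset.mem_filter, Finset.mem_powersetCard]
  constructor
  · rintro ⟨⟨_, h⟩, h2⟩; exact ⟨h, h2⟩
  · rintro ⟨h, h2⟩
    refine ⟨⟨?_, h⟩, h2⟩
    intro x hx
    rw [Finset.mem_range, Nat.lt_succ_iff, ← h2]
    exact Finset.single_le_sum (f := fun x => x) (fun _ _ => Nat.zero_le _) hx

/-- sum over functions -/
def ZZ (m K : ℕ) : ℂ := ∑ x ∈ Finset.piAntidiag (Finset.univ : Finset (Fin m)) K, FF x ^ 2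

theorem ZZ_eq (m K : ℕ) : ZZ m K = (m.factorial : ℂ) * ∑ X ∈ BB m K, ((hkp X) ^ 2)⁻¹ := by
  classical
  unfold ZZ
  rw [← Finset.sum_filter_add_sum_filter_not _ (fun x : Fin m → ℕ => Function.Injective x)]
  rw [Finset.sum_eq_zero (s := Finset.filter (fun x => ¬ Function.Injective x) _), add_zero]
  swap
  · intro x hx
    rw [FF_zero_of_not_inj x (Finset.mem_filter.1 hx).2]; simp
  rw [← Finset.sum_fiberwise_of_maps_to (t := BB m K) (g := fun x => Finset.univ.image x)]
  swap
  · intro x hx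
    simp only [Finset.mem_filter, Finset.mem_piAntidiag] at hx
    rw [mem_BB, Finset.card_image_of_injective _ hx.2,
      Finset.sum_image (fun a _ b _ hab => hx.2 hab)]
    exact ⟨by simp, hx.1.1⟩
  rw [Finset.mul_sum]
  apply Finset.sum_congr rfl
  intro X hX
  rw [mem_BB] at hX
  have hi := (X.orderEmbOfFin hX.1).injective
  have himg : Finset.univ.image (X.orderEmbOfFin hX.1) = X := by simp
  have key : Finset.filter (fun x => Finset.univ.image x = X)
      (Finset.filter (fun x : Fin m → ℕ => Function.Injective x)
        (Finset.piAntidiag Finset.univ K)) =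
      (Finset.univ : Finset (Equiv.Perm (Fin m))).image (fun σ : Equiv.Perm (Fin m) => (X.orderEmbOfFin hX.1) ∘ σ) := by
    ext x
    simp only [Finset.mem_filter, Finset.mem_piAntidiag, Finset.mem_univ, implies_true, and_true,
      Finset.mem_image, true_and]
    constructor
    · rintro ⟨⟨h1, h2⟩, h3⟩
      have hm : ∀ i, x i ∈ X := fun i => by rw [← h3]; simp
      let g : Fin m → Fin m := fun i => (X.orderIsoOfFin hX.1).symm ⟨x i, hm i⟩
      have hg : Function.Injective g := by
        intro a b hab
        have := (X.orderIsoOfFin hX.1).symm.injective hab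
        exact h2 (by simpa using this)
      refine ⟨Equiv.ofBijective g (Finite.injective_iff_bijective.1 hg), ?_⟩
      ext i
      simp [g, ← Finset.coe_orderIsoOfFin_apply]
    · rintro ⟨σ, rfl⟩
      have : Finset.univ.image ((X.orderEmbOfFin hX.1) ∘ σ) = X := by
        rw [← Finset.image_image]
        simp
      refine ⟨⟨?_, hi.comp σ.injective⟩, this⟩
      refine Eq.trans ?_ hX.2
      conv_rhs => rw [← this]
      rw [Finset.sum_image (fun a _ b _ hab => (hi.comp σ.injective) hab)]
  rw [key, Finset.sum_image]
  · simp_rw [FF_perm_sq, FF_sorted]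
    simp [Fintype.card_perm]
  · intro a _ b _ hab
    apply Equiv.ext
    intro i
    have := congrFun hab i
    simpa using this

theorem ZZ_succ (m n : ℕ) (hn : n < m) :
    ((n : ℂ) + 1) * ZZ m (n + 1 + ∑ j : Fin m, (j : ℕ)) = ZZ m (n + ∑ j : Fin m, (j : ℕ)) := by
  classical
  unfold ZZ
  set C := ∑ j : Fin m, (j : ℕ) with hC
  have h1 : ∀ x ∈ Finset.piAntidiag (Finset.univ : Finset (Fin m)) (n + 1 + C),
      ((n : ℂ) + 1) * FF x ^ 2 =
        ∑ i, (if x i = 0 then 0 else FF x * FF (Function.update x i (x i - 1))) := by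
    intro x hx
    simp only [Finset.mem_piAntidiag] at hx
    have h2 := FF_lower x
    have h3 : (∑ i, (x i : ℂ)) - ∑ j : Fin m, (j : ℂ) = n + 1 := by
      have := congrArg (Nat.cast : ℕ → ℂ) hx.1
      rw [hC] at this
      push_cast at this
      rw [this]; ring
    rw [h3] at h2
    rw [pow_two, ← mul_assoc, ← h2, Finset.sum_mul]
    apply Finset.sum_congr rfl
    intro i _
    split_ifs <;> ring
  have h2 : ∀ y ∈ Finset.piAntidiag (Finset.univ : Finset (Fin m)) (n + C),
      FF y ^ 2 = ∑ i, FF y * FF (Function.update y i (y i + 1)) := by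
    intro y hy
    simp only [Finset.mem_piAntidiag] at hy
    rw [← Finset.mul_sum]
    by_cases hinj : Function.Injective y
    · obtain ⟨i0, h0⟩ : ∃ i0, y i0 = 0 := by
        by_contra hcon
        push Not at hcon
        have hX : ∑ x ∈ Finset.univ.image y, x = ∑ i, y i :=
          Finset.sum_image (fun a _ b _ hab => hinj hab)
        have hcard : (Finset.univ.image y).card = m := by
          rw [Finset.card_image_of_injective _ hinj]; simp
        have hle : C + m ≤ ∑ i, y i := by
          rw [← hX]
          have hmono : ∀ j : Fin m, (j : ℕ) + 1 ≤ (Finset.univ.image y).orderEmbOfFin hcard j := by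
            intro ⟨j, hj⟩
            induction j with
            | zero =>
              have := Finset.orderEmbOfFin_mem (Finset.univ.image y) hcard ⟨0, hj⟩
              simp only [Finset.mem_image] at this
              obtain ⟨a, _, ha⟩ := this
              have := hcon a
              simp only
              omega
            | succ j ih =>
              have h5 := ih (by omega)
              have h6 : (Finset.univ.image y).orderEmbOfFin hcard ⟨j, by omega⟩ <
                (Finset.univ.image y).orderEmbOfFin hcard ⟨j + 1, hj⟩ := by
                simp
              simp only at h5 ⊢
              omega
          have h7 : ∑ x ∈ Finset.univ.image y, x =
              ∑ j, (Finset.univ.image y).orderEmbOfFin hcard j := by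
            conv_lhs => rw [← Finset.image_orderEmbOfFin_univ (Finset.univ.image y) hcard]
            rw [Finset.sum_image]
            intro a _ b _ hab
            exact ((Finset.univ.image y).orderEmbOfFin hcard).injective hab
          rw [h7]
          calc C + m = ∑ j : Fin m, ((j : ℕ) + 1) := by rw [Finset.sum_add_distrib]; simp [hC]
            _ ≤ _ := Finset.sum_le_sum (fun j _ => hmono j)
        rw [hy.1] at hle
        omega
      rw [FF_raise y i0 h0, pow_two]
    · rw [FF_zero_of_not_inj y hinj]; simp
  rw [Finset.mul_sum, Finset.sum_congr rfl h1, Finset.sum_congr rfl h2]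
  rw [← Finset.sum_product', ← Finset.sum_product']
  rw [← Finset.sum_filter_add_sum_filter_not _ (fun p : (Fin m → ℕ) × Fin m => p.1 p.2 = 0)]
  rw [Finset.sum_eq_zero, zero_add]
  swap
  · intro p hp
    rw [if_pos (Finset.mem_filter.1 hp).2]
  refine Finset.sum_bij' (fun p _ => (Function.update p.1 p.2 (p.1 p.2 - 1), p.2))
    (fun p _ => (Function.update p.1 p.2 (p.1 p.2 + 1), p.2)) ?_ ?_ ?_ ?_ ?_
  · rintro ⟨x, i⟩ hp
    simp only [Finset.mem_filter, Finset.mem_product, Finset.mem_piAntidiag, Finset.mem_univ,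
      implies_true, and_true] at hp ⊢
    rw [Finset.sum_update_of_mem (Finset.mem_univ i)]
    have : ∑ a ∈ Finset.univ \ {i}, x a + x i = Finset.univ.sum x := by
      rw [← Finset.erase_eq]
      exact Finset.sum_erase_add Finset.univ x (Finset.mem_univ i)
    omega
  · rintro ⟨x, i⟩ hp
    simp only [Finset.mem_filter, Finset.mem_product, Finset.mem_piAntidiag, Finset.mem_univ,
      implies_true, and_true] at hp ⊢
    rw [Finset.sum_update_of_mem (Finset.mem_univ i)]
    have : ∑ a ∈ Finset.univ \ {i}, x a + x i = Finset.univ.sum x := by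
      rw [← Finset.erase_eq]
      exact Finset.sum_erase_add Finset.univ x (Finset.mem_univ i)
    simp
    omega
  · rintro ⟨x, i⟩ hp
    simp only [Finset.mem_filter] at hp
    have : x i - 1 + 1 = x i := by omega
    simp [this]
  · rintro ⟨x, i⟩ hp
    simp
  · rintro ⟨x, i⟩ hp
    simp only [Finset.mem_filter] at hp
    have : x i - 1 + 1 = x i := by omega
    simp [this, hp.2, mul_comm]

theorem sum_hkp (m n : ℕ) (hn : n ≤ m) :
    ∑ X ∈ BB m (n + ∑ j : Fin m, (j : ℕ)), ((hkp X) ^ 2)⁻¹ = ((n.factorial : ℂ))⁻¹ := by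
  have hm : (m.factorial : ℂ) ≠ 0 := by exact_mod_cast m.factorial_ne_zero
  induction n with
  | zero =>
    have : BB m (0 + ∑ j : Fin m, (j : ℕ)) = {Finset.range m} := by
      ext X
      rw [mem_BB, Finset.mem_singleton, zero_add]
      constructor
      · rintro ⟨h1, h2⟩
        have hmono : ∀ j : Fin m, (j : ℕ) ≤ X.orderEmbOfFin h1 j := by
          intro ⟨j, hj⟩
          induction j with
          | zero => simp
          | succ j ih =>
            have h5 := ih (by omega)
            have h6 : X.orderEmbOfFin h1 ⟨j, by omega⟩ < X.orderEmbOfFin h1 ⟨j + 1, hj⟩ := by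
              simp
            simp only at h5 ⊢
            omega
        have h7 : ∑ x ∈ X, x = ∑ j, X.orderEmbOfFin h1 j := by
          conv_lhs => rw [← Finset.image_orderEmbOfFin_univ X h1]
          rw [Finset.sum_image]
          intro a _ b _ hab
          exact (X.orderEmbOfFin h1).injective hab
        rw [h7] at h2
        have h8 := (Finset.sum_eq_sum_iff_of_le (fun j _ => hmono j)).1 h2.symm
        rw [← Finset.image_orderEmbOfFin_univ X h1]
        ext y
        simp only [Finset.mem_image, Finset.mem_univ, true_and, Finset.mem_range]
        constructor
        · rintro ⟨j, rfl⟩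
          rw [← h8 j (Finset.mem_univ _)]; exact j.2
        · intro hy
          exact ⟨⟨y, hy⟩, (h8 _ (Finset.mem_univ _)).symm⟩
      · rintro rfl
        exact ⟨by simp, (Fin.sum_univ_eq_sum_range (fun j => j) m).symm⟩
    rw [this, Finset.sum_singleton]
    have : hkp (Finset.range m) = 1 := by
      unfold hkp
      apply Finset.prod_eq_one
      intro x hx
      apply Finset.prod_eq_one
      intro y hy
      simp at hx hy
      omega
    rw [this]; simp
  | succ n ih =>
    have h1 := ih (by omega)
    have h2 := ZZ_succ m n (by omega)
    rw [ZZ_eq, ZZ_eq, h1] at h2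
    have hn1 : (n : ℂ) + 1 ≠ 0 := by exact_mod_cast n.succ_ne_zero
    rw [mul_left_comm] at h2
    have h3 := mul_left_cancel₀ hm h2
    rw [Nat.factorial_succ]
    push_cast
    rw [mul_inv, ← h3, ← mul_assoc, inv_mul_cancel₀ hn1, one_mul]

/-- bead set of a charged pair -/
def beadset (P Q : Finset ℕ) : Set ℤ :=
  {z | (0 ≤ z ∧ z.toNat ∈ P) ∨ (z < 0 ∧ (-1 - z).toNat ∉ Q)}

/-- hooks of a bead set -/
def hks (S : Set ℤ) : Set (ℤ × ℤ) := {p | p.1 ∈ S ∧ p.2 ∉ S ∧ p.2 < p.1}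

/-- hook weight -/
def wt {M : Type*} [CommMonoid M] (g : ℤ → M) (S : Set ℤ) : M :=
  ∏ᶠ p ∈ hks S, g (p.1 - p.2)

def toX (N : ℕ) (p : Finset ℕ × Finset ℕ) : Finset ℕ :=
  p.1.image (· + N) ∪ (Finset.range N).filter (fun y => N - 1 - y ∉ p.2)

def toPQ (N : ℕ) (X : Finset ℕ) : Finset ℕ × Finset ℕ :=
  ((X.filter (N ≤ ·)).image (· - N), (Finset.range N).filter (fun q => N - 1 - q ∉ X))

theorem mem_toX {N : ℕ} {p : Finset ℕ × Finset ℕ} {x : ℕ} :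
    x ∈ toX N p ↔ (N ≤ x ∧ x - N ∈ p.1) ∨ (x < N ∧ N - 1 - x ∉ p.2) := by
  simp only [toX, Finset.mem_union, Finset.mem_image, Finset.mem_filter, Finset.mem_range]
  constructor
  · rintro (⟨a, ha, rfl⟩ | h)
    · left; exact ⟨by omega, by simpa using ha⟩
    · exact Or.inr h
  · rintro (⟨h1, h2⟩ | h)
    · left; exact ⟨x - N, h2, by omega⟩
    · exact Or.inr h

theorem mem_toPQ_fst {N : ℕ} {X : Finset ℕ} {k : ℕ} : k ∈ (toPQ N X).1 ↔ k + N ∈ X := by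
  simp only [toPQ, Finset.mem_image, Finset.mem_filter]
  constructor
  · rintro ⟨a, ⟨h1, h2⟩, rfl⟩
    rwa [Nat.sub_add_cancel h2]
  · intro h
    exact ⟨k + N, ⟨h, by omega⟩, by omega⟩

theorem mem_toPQ_snd {N : ℕ} {X : Finset ℕ} {k : ℕ} :
    k ∈ (toPQ N X).2 ↔ k < N ∧ N - 1 - k ∉ X := by
  simp [toPQ]

theorem toX_toPQ (N : ℕ) (X : Finset ℕ) : toX N (toPQ N X) = X := by
  ext x
  rw [mem_toX, mem_toPQ_fst, mem_toPQ_snd]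
  by_cases h : x < N
  · have h1 : N - 1 - (N - 1 - x) = x := by omega
    rw [h1]
    have h2 : ¬ N ≤ x := by omega
    have h3 : N - 1 - x < N := by omega
    simp [h, h2, h3]
  · have h2 : N ≤ x := by omega
    rw [Nat.sub_add_cancel h2]
    simp [h, h2]

theorem toPQ_toX (N : ℕ) (p : Finset ℕ × Finset ℕ) (h : p.2 ⊆ Finset.range N) :
    toPQ N (toX N p) = p := by
  ext k
  · rw [mem_toPQ_fst, mem_toX]
    simp
  · rw [mem_toPQ_snd, mem_toX]
    constructor
    · rintro ⟨h1, h2⟩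
      push Not at h2
      have := h2.2 (by omega)
      rwa [show N - 1 - (N - 1 - k) = k by omega] at this
    · intro hk
      have := Finset.mem_range.1 (h hk)
      refine ⟨this, ?_⟩
      rw [show N - 1 - (N - 1 - k) = k by omega]
      push Not
      exact ⟨fun _ => by omega, fun _ => hk⟩

theorem toPQ_subset (N : ℕ) (X : Finset ℕ) : (toPQ N X).2 ⊆ Finset.range N :=
  Finset.filter_subset _ _

theorem mem_toX_iff {N : ℕ} {p : Finset ℕ × Finset ℕ} {x : ℕ} :
    x ∈ toX N p ↔ (x : ℤ) - N ∈ beadset p.1 p.2 := by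
  rw [mem_toX]
  simp only [beadset, Set.mem_ofPred_eq]
  have h1 : (N ≤ x) ↔ (0 ≤ (x : ℤ) - N) := by omega
  have h2 : (x < N) ↔ ((x : ℤ) - N < 0) := by omega
  have h3 : x - N = ((x : ℤ) - N).toNat := by omega
  rw [h1, h2, h3]
  apply or_congr Iff.rfl
  apply and_congr_right
  intro h
  rw [show N - 1 - x = (-1 - ((x : ℤ) - N)).toNat by omega]

theorem wt_eq {M : Type*} [CommMonoid M] (g : ℤ → M) (N : ℕ) (p : Finset ℕ × Finset ℕ)
    (h : p.2 ⊆ Finset.range N) :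
    wt g (beadset p.1 p.2) = ∏ x ∈ toX N p, ∏ y ∈ (Finset.range x).filter (· ∉ toX N p),
      g ((x : ℤ) - y) := by
  rw [Finset.prod_sigma', ← finprod_mem_coe_finset]
  unfold wt
  have low : ∀ z : ℤ, z < -N → z ∈ beadset p.1 p.2 := by
    intro z hz
    right
    refine ⟨by omega, fun hc => ?_⟩
    have := Finset.mem_range.1 (h hc)
    omega
  refine finprod_mem_eq_of_bijOn (fun q : ℤ × ℤ => (⟨(q.1 + N).toNat, (q.2 + N).toNat⟩ : Σ _ : ℕ, ℕ))
    ⟨?_, ?_, ?_⟩ ?_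
  · rintro ⟨s, u⟩ ⟨hs, hu, hlt⟩
    simp only at hs hu hlt
    have hu' : -(N : ℤ) ≤ u := by
      by_contra hc
      exact hu (low u (by omega))
    simp only [Finset.coe_sigma, Set.mem_sigma_iff, Finset.mem_coe, Finset.mem_filter,
      Finset.mem_range, mem_toX_iff]
    rw [show ((s + N).toNat : ℤ) - N = s by omega, show ((u + N).toNat : ℤ) - N = u by omega]
    exact ⟨hs, by omega, hu⟩
  · rintro ⟨s, u⟩ ⟨hs, hu, hlt⟩ ⟨s', u'⟩ ⟨hs', hu', hlt'⟩ heq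
    simp only at hs hu hlt hs' hu' hlt'
    have h1 : -(N : ℤ) ≤ u := by
      by_contra hc
      exact hu (low u (by omega))
    have h2 : -(N : ℤ) ≤ u' := by
      by_contra hc
      exact hu' (low u' (by omega))
    simp only [Sigma.mk.injEq, heq_eq_eq] at heq
    ext <;> simp only <;> omega
  · rintro ⟨x, y⟩ hxy
    simp only [Finset.coe_sigma, Set.mem_sigma_iff, Finset.mem_coe, Finset.mem_filter,
      Finset.mem_range, mem_toX_iff] at hxy
    refine ⟨((x : ℤ) - N, (y : ℤ) - N), ⟨hxy.1, hxy.2.2, by simp; exact hxy.2.1⟩, ?_⟩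
    simp
  · rintro ⟨s, u⟩ ⟨hs, hu, hlt⟩
    simp only at hs hu hlt
    have h1 : -(N : ℤ) ≤ u := by
      by_contra hc
      exact hu (low u (by omega))
    simp only
    congr 1
    omega

/-- number of hooks of a finite bead set -/
def nhk (X : Finset ℕ) : ℕ := ∑ x ∈ X, ((Finset.range x).filter (· ∉ X)).card

theorem nhk_add (X : Finset ℕ) : nhk X + ∑ j : Fin X.card, (j : ℕ) = ∑ x ∈ X, x := by
  have h1 : ∑ x ∈ X, ((Finset.range x).filter (· ∈ X)).card = ∑ j : Fin X.card, (j : ℕ) := by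
    rw [Fin.sum_univ_eq_sum_range (fun j => j) X.card]
    induction X using Finset.induction_on_max with
    | empty => simp
    | insert a s ha ih =>
      have has : a ∉ s := fun h => lt_irrefl _ (ha a h)
      rw [Finset.sum_insert has, Finset.card_insert_of_notMem has, Finset.sum_range_succ, add_comm]
      congr 1
      · rw [← ih]
        apply Finset.sum_congr rfl
        intro x hx
        congr 1
        ext y
        simp only [Finset.mem_filter, Finset.mem_range, Finset.mem_insert]
        have := ha x hx
        constructor
        · rintro ⟨h1, h2 | h2⟩
          · omega
          · exact ⟨h1, h2⟩
        · rintro ⟨h1, h2⟩; exact ⟨h1, Or.inr h2⟩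
      · congr 1
        ext y
        simp only [Finset.mem_filter, Finset.mem_range, Finset.mem_insert]
        constructor
        · rintro ⟨h1, h2 | h2⟩
          · omega
          · exact h2
        · intro h; exact ⟨ha y h, Or.inr h⟩
  rw [← h1, nhk, ← Finset.sum_add_distrib]
  apply Finset.sum_congr rfl
  intro x _
  rw [add_comm, Finset.card_filter_add_card_filter_not, Finset.card_range]

theorem card_toX (N : ℕ) (p : Finset ℕ × Finset ℕ) (h : p.2 ⊆ Finset.range N) :
    (toX N p).card + p.2.card = N + p.1.card ∧
    2 * (∑ x ∈ toX N p, (x : ℤ)) = 2 * (∑ k ∈ p.1, (k : ℤ) + ∑ k ∈ p.2, (k : ℤ)) +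
      2 * N * p.1.card - 2 * (N - 1) * p.2.card + N * (N - 1) := by
  classical
  have hd : Disjoint (p.1.image (· + N)) ((Finset.range N).filter (fun y => N - 1 - y ∉ p.2)) := by
    rw [Finset.disjoint_left]
    intro a h1 h2
    simp only [Finset.mem_image, Finset.mem_filter, Finset.mem_range] at h1 h2
    obtain ⟨k, _, rfl⟩ := h1
    omega
  have hinj : Set.InjOn (· + N) (p.1 : Set ℕ) := fun a _ b _ hab => by simpa using hab
  have hQ : (Finset.range N).filter (fun y => N - 1 - y ∈ p.2) = p.2.image (fun q => N - 1 - q) := by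
    ext y
    simp only [Finset.mem_filter, Finset.mem_range, Finset.mem_image]
    constructor
    · rintro ⟨h1, h2⟩; exact ⟨_, h2, by omega⟩
    · rintro ⟨q, hq, rfl⟩
      have := Finset.mem_range.1 (h hq)
      exact ⟨by omega, by rwa [show N - 1 - (N - 1 - q) = q by omega]⟩
  have hinj2 : Set.InjOn (fun q => N - 1 - q) (p.2 : Set ℕ) := by
    intro a ha b hb hab
    have h1 := Finset.mem_range.1 (h ha)
    have h2 := Finset.mem_range.1 (h hb)
    simp only at hab
    omega
  constructor
  · unfold toX
    rw [Finset.card_union_of_disjoint hd, Finset.card_image_of_injOn hinj]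
    have := Finset.card_filter_add_card_filter_not (s := Finset.range N) (fun y => N - 1 - y ∈ p.2)
    rw [hQ, Finset.card_image_of_injOn hinj2, Finset.card_range] at this
    omega
  · unfold toX
    rw [Finset.sum_union hd, Finset.sum_image hinj]
    have h1 := Finset.sum_filter_add_sum_filter_not (s := Finset.range N)
      (fun y => N - 1 - y ∈ p.2) (fun y => (y : ℤ))
    rw [hQ, Finset.sum_image hinj2] at h1
    have h2 : ∑ q ∈ p.2, ((N - 1 - q : ℕ) : ℤ) = ∑ q ∈ p.2, ((N : ℤ) - 1 - q) := by
      apply Finset.sum_congr rfl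
      intro q hq
      have := Finset.mem_range.1 (h hq)
      omega
    rw [h2, Finset.sum_sub_distrib] at h1
    have h3 : (∑ y ∈ Finset.range N, (y : ℤ)) * 2 = N * (N - 1) := by
      have := Finset.sum_range_id_mul_two N
      rcases N with _ | N
      · simp
      · have := congrArg (Nat.cast : ℕ → ℤ) this
        push_cast at this ⊢
        rw [this]; simp
    simp only [Finset.sum_const, nsmul_eq_mul] at h1
    push_cast
    rw [Finset.sum_add_distrib, Finset.sum_const, nsmul_eq_mul]
    linear_combination 2 * h1 + h3

theorem two_sum_fin (m : ℕ) : 2 * ((∑ j : Fin m, (j : ℕ) : ℕ) : ℤ) = m * (m - 1) := by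
  rw [Fin.sum_univ_eq_sum_range (fun j => j) m]
  have := Finset.sum_range_id_mul_two m
  rcases m with _ | N
  · simp
  · have := congrArg (Nat.cast : ℕ → ℤ) this
    push_cast at this ⊢
    rw [mul_comm, this]; simp

/-- charge -/
def chg (p : Finset ℕ × Finset ℕ) : ℤ := (p.1.card : ℤ) - p.2.card

theorem nhk_toX (N : ℕ) (p : Finset ℕ × Finset ℕ) (h : p.2 ⊆ Finset.range N) :
    2 * (nhk (toX N p) : ℤ) = 2 * (∑ k ∈ p.1, (k : ℤ) + ∑ k ∈ p.2, (k : ℤ) + p.2.card)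
      - chg p * (chg p - 1) := by
  have h1 := congrArg (Nat.cast : ℕ → ℤ) (nhk_add (toX N p))
  have h2 := two_sum_fin (toX N p).card
  obtain ⟨h3, h4⟩ := card_toX N p h
  have h5 : ((toX N p).card : ℤ) = N + p.1.card - p.2.card := by omega
  rw [h5] at h2
  push_cast at h1 h2
  unfold chg
  linear_combination 2 * h1 - h2 + h4

/-- excess -/
def exc (p : Finset ℕ × Finset ℕ) : ℕ := nhk (toX (p.2.sup id + 1) p)

theorem sub_range_sup (Q : Finset ℕ) : Q ⊆ Finset.range (Q.sup id + 1) := by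
  intro q hq
  rw [Finset.mem_range, Nat.lt_succ_iff]
  exact Finset.le_sup (f := id) hq

theorem two_exc (p : Finset ℕ × Finset ℕ) :
    2 * (exc p : ℤ) = 2 * (∑ k ∈ p.1, (k : ℤ) + ∑ k ∈ p.2, (k : ℤ) + p.2.card)
      - chg p * (chg p - 1) := nhk_toX _ p (sub_range_sup p.2)

theorem exc_eq (N : ℕ) (p : Finset ℕ × Finset ℕ) (h : p.2 ⊆ Finset.range N) :
    exc p = nhk (toX N p) := by
  have h1 := nhk_toX N p h
  have h2 := two_exc p
  omega

/-- cutoff -/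
def cut (c : ℤ) (n : ℕ) : ℕ := n + c.natAbs * c.natAbs + c.natAbs + 1

/-- number of beads -/
def cm (c : ℤ) (n : ℕ) : ℕ := (cut c n + c).toNat

theorem cm_ge (c : ℤ) (n : ℕ) : n ≤ cm c n ∧ (cm c n : ℤ) = cut c n + c := by
  unfold cm cut
  have : 0 ≤ c.natAbs * c.natAbs := Nat.zero_le _
  generalize c.natAbs * c.natAbs = z at *
  omega

/-- fiber over given charge and excess -/
def fibF (c : ℤ) (n : ℕ) : Finset (Finset ℕ × Finset ℕ) :=
  (BB (cm c n) (n + ∑ j : Fin (cm c n), (j : ℕ))).image (toPQ (cut c n))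

theorem sub_cut (c : ℤ) (n : ℕ) (p : Finset ℕ × Finset ℕ) (h : chg p = c) (h2 : exc p = n) :
    p.2 ⊆ Finset.range (cut c n) := by
  intro q hq
  rw [Finset.mem_range]
  have h3 := two_exc p
  rw [h, h2] at h3
  have h4 : (q : ℤ) ≤ ∑ k ∈ p.2, (k : ℤ) :=
    Finset.single_le_sum (f := fun k : ℕ => (k : ℤ)) (fun _ _ => by positivity) hq
  have h5 : (0 : ℤ) ≤ ∑ k ∈ p.1, (k : ℤ) := Finset.sum_nonneg (fun _ _ => by positivity)
  unfold cut
  zify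
  rw [abs_mul_abs_self]
  have h6 := neg_abs_le c
  have h7 := abs_nonneg c
  have h8 : (0 : ℤ) ≤ p.2.card := by positivity
  have h9 : 0 ≤ c * c := mul_self_nonneg c
  nlinarith

theorem mem_fibF (c : ℤ) (n : ℕ) (p : Finset ℕ × Finset ℕ) :
    p ∈ fibF c n ↔ chg p = c ∧ exc p = n := by
  obtain ⟨h1, h2⟩ := cm_ge c n
  simp only [fibF, Finset.mem_image, mem_BB]
  constructor
  · rintro ⟨X, ⟨h3, h4⟩, rfl⟩
    have h5 := toPQ_subset (cut c n) X
    obtain ⟨h6, _⟩ := card_toX _ _ h5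
    rw [toX_toPQ] at h6
    constructor
    · unfold chg
      omega
    · rw [exc_eq _ _ h5, toX_toPQ]
      have := nhk_add X
      rw [h3] at this
      omega
  · rintro ⟨h3, h4⟩
    have h5 := sub_cut c n p h3 h4
    obtain ⟨h6, _⟩ := card_toX _ _ h5
    have h7 : (toX (cut c n) p).card = cm c n := by
      unfold chg at h3
      omega
    refine ⟨toX (cut c n) p, ⟨h7, ?_⟩, toPQ_toX _ _ h5⟩
    rw [← nhk_add, ← exc_eq _ _ h5, h4, h7]

theorem sum_fibF (c : ℤ) (n : ℕ) (w : Finset ℕ × Finset ℕ → ℂ) :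
    ∑ p ∈ fibF c n, w p =
      ∑ X ∈ BB (cm c n) (n + ∑ j : Fin (cm c n), (j : ℕ)), w (toPQ (cut c n) X) := by
  unfold fibF
  rw [Finset.sum_image]
  intro X _ Y _ h
  rw [← toX_toPQ (cut c n) X, h, toX_toPQ]

theorem sum_fibF_hook (b : ℂ) (c : ℤ) (n : ℕ) :
    ∑ p ∈ fibF c n, wt (fun h : ℤ => -(b / (h : ℂ)) ^ 2) (beadset p.1 p.2) =
      (-b ^ 2) ^ n / (n.factorial : ℂ) := by
  rw [sum_fibF, div_eq_mul_inv, ← sum_hkp _ n (cm_ge c n).1, Finset.mul_sum]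
  apply Finset.sum_congr rfl
  intro X hX
  rw [wt_eq _ (cut c n) _ (toPQ_subset _ _), toX_toPQ]
  rw [mem_BB] at hX
  have h1 := nhk_add X
  rw [hX.1, hX.2] at h1
  have h2 : nhk X = n := by omega
  have h3 : (-b ^ 2) ^ n = ∏ x ∈ X, ∏ y ∈ (Finset.range x).filter (· ∉ X), (-b ^ 2) := by
    simp_rw [Finset.prod_const]
    rw [Finset.prod_pow_eq_pow_sum, ← h2, nhk]
  rw [h3, hkp, ← Finset.prod_pow, ← Finset.prod_inv_distrib, ← Finset.prod_mul_distrib]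
  apply Finset.prod_congr rfl
  intro x _
  rw [← Finset.prod_pow, ← Finset.prod_inv_distrib, ← Finset.prod_mul_distrib]
  apply Finset.prod_congr rfl
  intro y _
  push_cast
  rw [div_pow]
  ring

instance instT2PS : T2Space (PowerSeries ℂ) := PowerSeries.WithPiTopology.instT2Space ℂ
instance instTRPS : IsTopologicalRing (PowerSeries ℂ) := PowerSeries.WithPiTopology.instIsTopologicalRing ℂ
instance instT3PS : T3Space (PowerSeries ℂ) :=
  inferInstanceAs (T3Space ((Unit →₀ ℕ) → ℂ))

theorem ps_hasSum_iff {ι : Type*} {f : ι → PowerSeries ℂ} {g : PowerSeries ℂ} :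
    HasSum f g ↔ ∀ d, HasSum (fun i => coeff d (f i)) (coeff d g) :=
  PowerSeries.WithPiTopology.hasSum_iff_hasSum_coeff ℂ

theorem ps_tendsto_iff {ι : Type*} {f : ι → PowerSeries ℂ} {u : Filter ι} {g : PowerSeries ℂ} :
    Filter.Tendsto f u (nhds g) ↔
      ∀ d, Filter.Tendsto (fun i => coeff d (f i)) u (nhds (coeff d g)) :=
  PowerSeries.WithPiTopology.tendsto_iff_coeff_tendsto ℂ f u g

theorem ps_summable {ι : Type*} (e : ι → ℕ) (a : ι → ℂ) (hfin : ∀ d, {i | e i = d}.Finite) :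
    Summable (fun i => C (a i) * X ^ (e i) : ι → PowerSeries ℂ) := by
  have : ∀ d, Summable (fun i => coeff d (C (a i) * X ^ (e i) : PowerSeries ℂ)) := by
    intro d
    apply summable_of_hasFiniteSupport
    apply (hfin d).subset
    intro i hi
    simp only [Function.mem_support, coeff_C_mul, coeff_X_pow] at hi
    simp only [Set.mem_ofPred_eq]
    by_contra h
    apply hi
    rw [if_neg (fun h' => h h'.symm), mul_zero]
  exact ⟨PowerSeries.mk fun d => ∑' i, coeff d (C (a i) * X ^ (e i) : PowerSeries ℂ),
    ps_hasSum_iff.2 (fun d => by rw [coeff_mk]; exact (this d).hasSum)⟩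

theorem fin_le {ι : Type*} (e : ι → ℕ) (hfin : ∀ d, {i | e i = d}.Finite) (d : ℕ) :
    {i | e i ≤ d}.Finite := by
  have : {i | e i ≤ d} = ⋃ k ∈ Finset.range (d + 1), {i | e i = k} := by
    ext i
    simp
  rw [this]
  exact Set.Finite.biUnion (Finset.finite_toSet _) (fun k _ => hfin k)

theorem fin_pi {ι : Type*} {k : ℕ} (e : Fin k → ι → ℕ) (hfin : ∀ r d, {i | e r i = d}.Finite)
    (d : ℕ) : {g : Fin k → ι | ∑ r, e r (g r) = d}.Finite := by
  apply (Set.Finite.pi (fun r => fin_le (e r) (hfin r) d)).subset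
  intro g hg
  simp only [Set.mem_pi, Set.mem_univ, Set.mem_ofPred_eq, true_implies] at hg ⊢
  intro r
  rw [← hg]
  exact Finset.single_le_sum (f := fun r => e r (g r)) (fun _ _ => Nat.zero_le _) (Finset.mem_univ r)

theorem prod_tsum {ι : Type*} {k : ℕ} (e : Fin k → ι → ℕ) (a : Fin k → ι → ℂ)
    (hfin : ∀ r d, {i | e r i = d}.Finite) :
    ∏ r, ∑' i, (C (a r i) * X ^ (e r i) : PowerSeries ℂ) =
      ∑' g : Fin k → ι, (C (∏ r, a r (g r)) * X ^ (∑ r, e r (g r)) : PowerSeries ℂ) := by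
  induction k with
  | zero =>
    rw [tsum_fintype]
    simp
  | succ k ih =>
    rw [Fin.prod_univ_succ, ih (fun r => e r.succ) (fun r => a r.succ) (fun r => hfin r.succ)]
    obtain ⟨E, hE⟩ : ∃ E : ι × (Fin k → ι) ≃ (Fin (k + 1) → ι),
        ∀ z, E z = (Fin.cons z.1 z.2 : Fin (k + 1) → ι) :=
      ⟨Fin.consEquiv (fun _ => ι), fun z => rfl⟩
    have hs : ∀ z : ι × (Fin k → ι),
        (C (a 0 z.1) * X ^ (e 0 z.1) : PowerSeries ℂ) *
          (C (∏ r : Fin k, a r.succ (z.2 r)) * X ^ (∑ r : Fin k, e r.succ (z.2 r))) =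
        C (∏ r, a r (E z r)) *
          X ^ (∑ r, e r (E z r)) := by
      intro z
      simp only [Fin.prod_univ_succ, Fin.sum_univ_succ, hE,
        Fin.cons_zero, Fin.cons_succ, map_mul, pow_add]
      ring
    have s1 := ps_summable (e 0) (a 0) (hfin 0)
    have s2 := ps_summable (fun g : Fin k → ι => ∑ r, e r.succ (g r))
        (fun g => ∏ r, a r.succ (g r)) (fin_pi (fun r => e r.succ) (fun r => hfin r.succ))
    have s4 := ps_summable (fun g : Fin (k + 1) → ι => ∑ r, e r (g r)) (fun g => ∏ r, a r (g r))
          (fin_pi e hfin)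
    have s3 := E.summable_iff.2 s4
    have s5 := E.tsum_eq (fun g : Fin (k + 1) → ι => (C (∏ r, a r (g r)) * X ^ (∑ r, e r (g r)) : PowerSeries ℂ))
    rw [← s5]
    have s6 : Summable (fun z : ι × (Fin k → ι) => (C (a 0 z.1) * X ^ (e 0 z.1) : PowerSeries ℂ) *
          (C (∏ r : Fin k, a r.succ (z.2 r)) * X ^ (∑ r : Fin k, e r.succ (z.2 r)))) :=
      s3.congr (fun z => (hs z).symm)
    exact (s1.tsum_mul_tsum s2 s6).trans (tsum_congr hs)

/-- degree of a pair in residue class `r` -/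
def er (t r : ℕ) (p : Finset ℕ × Finset ℕ) : ℕ :=
  ∑ k ∈ p.1, (2 * (t * k + r) + 1) + ∑ k ∈ p.2, (2 * (t * k + (t - 1 - r)) + 1)

theorem fin_finset_sum (f : ℕ → ℕ) (hf : ∀ k, k < f k) (d : ℕ) :
    {P : Finset ℕ | ∑ k ∈ P, f k ≤ d}.Finite := by
  apply (Finset.finite_toSet (Finset.range d).powerset).subset
  intro P hP
  simp only [Finset.coe_powerset, Set.mem_preimage, Set.mem_powerset_iff, Finset.coe_subset,
    Set.mem_ofPred_eq] at hP ⊢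
  intro k hk
  rw [Finset.mem_range]
  have := Finset.single_le_sum (f := f) (fun _ _ => Nat.zero_le _) hk
  have := hf k
  omega

theorem er_fin (t r : ℕ) (ht : 0 < t) (d : ℕ) : {p | er t r p = d}.Finite := by
  have h1 : ∀ u k : ℕ, k < 2 * (t * k + u) + 1 := by
    intro u k
    have : k ≤ t * k := Nat.le_mul_of_pos_left k ht
    omega
  apply ((fin_finset_sum _ (h1 r) d).prod (fin_finset_sum _ (h1 (t - 1 - r)) d)).subset
  rintro p hp
  simp only [Set.mem_ofPred_eq, er] at hp
  simp only [Set.mem_prod, Set.mem_ofPred_eq]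
  omega

/-- exponent of theta function -/
def kap (t r : ℕ) (c : ℤ) : ℤ := t * (c * (c - 1)) + (2 * r + 1) * c

theorem kap_ge (t r : ℕ) (hr : r < t) (c : ℤ) : (c.natAbs : ℤ) ≤ kap t r c := by
  unfold kap
  rcases le_total 0 c with h | h
  · have h1 : (0 : ℤ) ≤ c * (c - 1) := by
      rcases h.eq_or_lt with h | h
      · simp [← h]
      · exact mul_nonneg (by omega) (by omega)
    have h2 : (0 : ℤ) ≤ t * (c * (c - 1)) := by positivity
    have h3 : (0 : ℤ) ≤ r * c := by positivity
    have h4 : (c.natAbs : ℤ) = c := by omega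
    rw [h4]
    nlinarith
  · obtain ⟨a, rfl⟩ : ∃ a : ℕ, c = -a := ⟨c.natAbs, by omega⟩
    have h4 : ((-(a : ℤ)).natAbs : ℤ) = a := by omega
    rw [h4]
    have h5 : (r : ℤ) + 1 ≤ t := by omega
    have h6 : (0 : ℤ) ≤ a * (a - 1) := by
      rcases Nat.eq_zero_or_pos a with h | h
      · simp [h]
      · exact mul_nonneg (by omega) (by omega)
    have h7 : (0 : ℤ) ≤ t * (a * (a - 1)) := by positivity
    have h8 : (0 : ℤ) ≤ (t - r - 1) * a := mul_nonneg (by omega) (by positivity)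
    nlinarith

theorem er_eq (t r : ℕ) (hr : r < t) (p : Finset ℕ × Finset ℕ) :
    er t r p = (kap t r (chg p)).toNat + 2 * t * exc p := by
  have h1 := kap_ge t r hr (chg p)
  have h2 := two_exc p
  zify
  rw [Int.toNat_of_nonneg (by omega)]
  unfold er kap
  push_cast
  have h3 : ((t - 1 - r : ℕ) : ℤ) = t - 1 - r := by omega
  rw [h3]
  simp only [Finset.sum_add_distrib, ← Finset.mul_sum, Finset.sum_const, nsmul_eq_mul]
  have h4 : (p.1.card : ℤ) = chg p + p.2.card := by unfold chg; ring
  rw [h4]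
  linear_combination (-(t : ℤ)) * h2

/-- theta series -/
def theta (t r : ℕ) : PowerSeries ℂ :=
  ∑' c : ℤ, C ((-1 : ℂ) ^ c.natAbs) * X ^ (kap t r c).toNat

theorem fiber_sum (t r : ℕ) (hr : r < t) (w : Finset ℕ × Finset ℕ → ℂ) (a : ℕ → ℂ)
    (hw : ∀ c n, ∑ p ∈ fibF c n, w p = a n) :
    ∑' p : Finset ℕ × Finset ℕ,
      (C ((-1) ^ (p.1.card + p.2.card) * w p) * X ^ (er t r p) : PowerSeries ℂ) =
      theta t r * ∑' n : ℕ, (C (a n) * X ^ (2 * t * n) : PowerSeries ℂ) := by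
  have ht : 0 < t := by omega
  have s1 : Summable (fun c : ℤ => (C ((-1 : ℂ) ^ c.natAbs) * X ^ (kap t r c).toNat : PowerSeries ℂ)) := by
    apply ps_summable
    intro d
    apply (Set.finite_Icc (-(d : ℤ)) d).subset
    intro c hc
    simp only [Set.mem_ofPred_eq] at hc
    have := kap_ge t r hr c
    simp only [Set.mem_Icc]
    omega
  have s2 : Summable (fun n : ℕ => (C (a n) * X ^ (2 * t * n) : PowerSeries ℂ)) := by
    apply ps_summable
    intro d
    apply (Set.finite_Iic d).subset
    intro n hn
    simp only [Set.mem_ofPred_eq] at hn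
    simp only [Set.mem_Iic]
    nlinarith
  have hz : ∀ z : ℤ × ℕ, (C ((-1 : ℂ) ^ z.1.natAbs) * X ^ (kap t r z.1).toNat : PowerSeries ℂ) *
      (C (a z.2) * X ^ (2 * t * z.2)) =
      C ((-1 : ℂ) ^ z.1.natAbs * a z.2) * X ^ ((kap t r z.1).toNat + 2 * t * z.2) := by
    intro z
    rw [map_mul, pow_add]; ring
  have s3 : Summable (fun z : ℤ × ℕ => (C ((-1 : ℂ) ^ z.1.natAbs) * X ^ (kap t r z.1).toNat : PowerSeries ℂ) *
      (C (a z.2) * X ^ (2 * t * z.2))) := by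
    simp_rw [hz]
    apply ps_summable
    intro d
    apply ((Set.finite_Icc (-(d : ℤ)) d).prod (Set.finite_Iic d)).subset
    intro z hz
    simp only [Set.mem_ofPred_eq] at hz
    have := kap_ge t r hr z.1
    simp only [Set.mem_prod, Set.mem_Icc, Set.mem_Iic]
    have : z.2 ≤ 2 * t * z.2 := Nat.le_mul_of_pos_left _ (by omega)
    omega
  unfold theta
  rw [s1.tsum_mul_tsum s2 s3]
  simp_rw [hz]
  have s4 := (ps_summable (er t r) (fun p => (-1) ^ (p.1.card + p.2.card) * w p)
    (er_fin t r ht)).hasSum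
  let f : Finset ℕ × Finset ℕ → ℤ × ℕ := fun p => (chg p, exc p)
  rw [← (Equiv.sigmaFiberEquiv f).hasSum_iff] at s4
  have s5 : HasSum (fun z : ℤ × ℕ =>
    (C ((-1 : ℂ) ^ z.1.natAbs * a z.2) * X ^ ((kap t r z.1).toNat + 2 * t * z.2) : PowerSeries ℂ))
    (∑' p : Finset ℕ × Finset ℕ,
      (C ((-1) ^ (p.1.card + p.2.card) * w p) * X ^ (er t r p) : PowerSeries ℂ)) := by
    refine s4.sigma (fun z => ?_)
    have h1 := (fibF z.1 z.2).hasSum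
      (fun p => (C ((-1) ^ (p.1.card + p.2.card) * w p) * X ^ (er t r p) : PowerSeries ℂ))
    have h2 : ∑ p ∈ fibF z.1 z.2,
        (C ((-1) ^ (p.1.card + p.2.card) * w p) * X ^ (er t r p) : PowerSeries ℂ) =
        C ((-1 : ℂ) ^ z.1.natAbs * a z.2) * X ^ ((kap t r z.1).toNat + 2 * t * z.2) := by
      rw [← hw z.1 z.2, Finset.mul_sum, map_sum, Finset.sum_mul]
      apply Finset.sum_congr rfl
      intro p hp
      rw [mem_fibF] at hp
      rw [er_eq t r hr p, hp.1, hp.2]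
      congr 3
      rw [← hp.1]
      apply neg_one_pow_congr
      rw [Int.natAbs_even]
      simp [chg, Int.even_sub, Nat.even_add]
    rw [h2] at h1
    let eqv : {p // f p = z} ≃ {p // p ∈ fibF z.1 z.2} := Equiv.subtypeEquivRight (fun p => by
      rw [mem_fibF]; simp [f, Prod.ext_iff])
    exact (eqv.hasSum_iff (f := fun q : {p // p ∈ fibF z.1 z.2} =>
      (C ((-1) ^ (q.1.1.card + q.1.2.card) * w q.1) * X ^ (er t r q.1) : PowerSeries ℂ))).2 h1
  exact s5.tsum_eq.symm

/-- shift a finset by one -/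
def sft (Y : Finset ℕ) : Finset ℕ := Y.map (addRightEmbedding 1)

theorem mem_sft {Y : Finset ℕ} {x : ℕ} : x ∈ sft Y ↔ ∃ y ∈ Y, y + 1 = x := by
  simp [sft]
theorem zero_notMem_sft (Y : Finset ℕ) : 0 ∉ sft Y := by
  simp [sft]
theorem card_sft (Y : Finset ℕ) : (sft Y).card = Y.card := by simp [sft]
theorem sum_sft (Y : Finset ℕ) : ∑ x ∈ sft Y, x = ∑ x ∈ Y, x + Y.card := by
  simp [sft, Finset.sum_add_distrib]
theorem sft_inj {Y Z : Finset ℕ} (h : sft Y = sft Z) : Y = Z := by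
  simpa [sft] using h
theorem exists_sft (X : Finset ℕ) (h : 0 ∉ X) : ∃ Y, X = sft Y := by
  refine ⟨X.image (· - 1), ?_⟩
  ext x
  rw [mem_sft]
  constructor
  · intro hx
    have : x ≠ 0 := fun h' => h (h' ▸ hx)
    exact ⟨x - 1, Finset.mem_image_of_mem _ hx, by omega⟩
  · rintro ⟨y, hy, rfl⟩
    obtain ⟨z, hz, rfl⟩ := Finset.mem_image.1 hy
    have : z ≠ 0 := fun h' => h (h' ▸ hz)
    rwa [show z - 1 + 1 = z by omega]

theorem BB_rec_in (m K : ℕ) :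
    ((BB (m + 1) (K + m)).filter (fun X => 0 ∈ X)).card = (BB m K).card := by
  symm
  apply Finset.card_bij (fun Y _ => insert 0 (sft Y))
  · intro Y hY
    rw [mem_BB] at hY
    simp only [Finset.mem_filter, mem_BB, Finset.mem_insert_self, and_true]
    rw [Finset.card_insert_of_notMem (zero_notMem_sft Y), Finset.sum_insert (zero_notMem_sft Y),
      card_sft, sum_sft]
    omega
  · intro Y _ Z _ h
    apply sft_inj
    have := congrArg (fun S => S.erase 0) h
    simpa [Finset.erase_insert (zero_notMem_sft _)] using this
  · intro X hX
    simp only [Finset.mem_filter, mem_BB] at hX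
    obtain ⟨Y, hY⟩ := exists_sft (X.erase 0) (by simp)
    have hX' : X = insert 0 (sft Y) := by rw [← hY, Finset.insert_erase hX.2]
    refine ⟨Y, ?_, hX'.symm⟩
    rw [hX', Finset.card_insert_of_notMem (zero_notMem_sft Y), Finset.sum_insert (zero_notMem_sft Y),
      card_sft, sum_sft] at hX
    rw [mem_BB]
    omega

theorem BB_rec_out (m K : ℕ) :
    ((BB m (K + m)).filter (fun X => 0 ∉ X)).card = (BB m K).card := by
  symm
  apply Finset.card_bij (fun Y _ => sft Y)
  · intro Y hY
    rw [mem_BB] at hY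
    simp only [Finset.mem_filter, mem_BB, card_sft, sum_sft]
    exact ⟨by omega, zero_notMem_sft Y⟩
  · intro Y _ Z _ h
    exact sft_inj h
  · intro X hX
    simp only [Finset.mem_filter, mem_BB] at hX
    obtain ⟨Y, hY⟩ := exists_sft X hX.2
    refine ⟨Y, ?_, hY.symm⟩
    rw [hY, card_sft, sum_sft] at hX
    rw [mem_BB]
    omega

theorem BB_le {m K : ℕ} {X : Finset ℕ} (h : X ∈ BB m K) : ∑ j : Fin m, (j : ℕ) ≤ K := by
  rw [mem_BB] at h
  have := nhk_add X
  rw [h.1, h.2] at this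
  omega

/-- partition numbers -/
def qn (m n : ℕ) : ℕ := (BB m (n + ∑ j : Fin m, (j : ℕ))).card

theorem qn_zero (n : ℕ) : qn 0 n = if n = 0 then 1 else 0 := by
  unfold qn
  split_ifs with h
  · subst h
    rw [Finset.card_eq_one]
    refine ⟨∅, ?_⟩
    ext X
    rw [mem_BB]
    simp +contextual [Finset.card_eq_zero]
  · rw [Finset.card_eq_zero]
    ext X
    rw [mem_BB]
    simp only [Finset.notMem_empty, iff_false]
    rintro ⟨h1, h2⟩
    rw [Finset.card_eq_zero] at h1
    subst h1
    simp at h2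
    omega

theorem qn_succ (m n : ℕ) : qn (m + 1) n = qn m n + if m + 1 ≤ n then qn (m + 1) (n - (m + 1)) else 0 := by
  unfold qn
  rw [← Finset.card_filter_add_card_filter_not (s := BB (m + 1) _) (fun X => 0 ∈ X)]
  congr 1
  · rw [← BB_rec_in]
    congr 3
    rw [Fin.sum_univ_castSucc]
    simp
    omega
  · split_ifs with h
    · rw [← BB_rec_out]
      congr 3
      omega
    · rw [Finset.card_eq_zero, Finset.filter_eq_empty_iff]
      intro X hX h0
      obtain ⟨Y, hY⟩ := exists_sft X h0
      rw [mem_BB, hY, card_sft, sum_sft] at hX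
      have := BB_le (mem_BB.2 ⟨hX.1, rfl⟩)
      omega

theorem qn_stable (m n : ℕ) (h : n ≤ m) : qn m n = qn n n := by
  induction m, h using Nat.le_induction with
  | base => rfl
  | succ m hm ih =>
    rw [qn_succ, if_neg (by omega), ih, add_zero]

/-- generating series -/
def Gn (m : ℕ) : PowerSeries ℂ := mk (fun n => (qn m n : ℂ))

theorem Gn_succ (m : ℕ) : Gn (m + 1) * (1 - X ^ (m + 1)) = Gn m := by
  ext n
  rw [mul_sub, mul_one, map_sub, coeff_mul_X_pow', Gn, Gn, coeff_mk, coeff_mk, qn_succ]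
  split_ifs <;> simp

theorem Gn_prod (m : ℕ) : Gn m * ∏ k ∈ Finset.range m, (1 - X ^ (k + 1)) = 1 := by
  induction m with
  | zero =>
    ext n
    simp [Gn, coeff_mk, qn_zero, coeff_one]
  | succ m ih =>
    rw [Finset.prod_range_succ, mul_comm _ (1 - X ^ (m + 1)), ← mul_assoc, Gn_succ, ih]

theorem tsum_expand (s : ℕ) (hs : s ≠ 0) (a : ℕ → ℂ) :
    ∑' n : ℕ, (C (a n) * X ^ (s * n) : PowerSeries ℂ) = expand s hs (mk a) := by
  apply HasSum.tsum_eq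
  rw [ps_hasSum_iff]
  intro d
  have h0 : ∀ n, coeff d (C (a n) * X ^ (s * n) : PowerSeries ℂ) = if d = s * n then a n else 0 := by
    intro n
    rw [coeff_C_mul, coeff_X_pow]
    simp
  simp_rw [h0]
  rw [coeff_expand]
  split_ifs with h
  · obtain ⟨q, rfl⟩ := h
    rw [Nat.mul_div_cancel_left _ (Nat.pos_of_ne_zero hs), coeff_mk]
    convert hasSum_single q ?_ using 1
    · simp
    · intro n hn
      rw [if_neg]
      intro h
      exact hn (Nat.eq_of_mul_eq_mul_left (Nat.pos_of_ne_zero hs) h).symm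
  · convert hasSum_zero with n
    rw [if_neg]
    rintro rfl
    exact h ⟨n, rfl⟩

theorem ps_summable' {ι : Type*} (e : ι → ℕ) (a : ι → PowerSeries ℂ) (hfin : ∀ d, {i | e i ≤ d}.Finite) :
    Summable (fun i => a i * X ^ (e i) : ι → PowerSeries ℂ) := by
  have : ∀ d, Summable (fun i => coeff d (a i * X ^ (e i) : PowerSeries ℂ)) := by
    intro d
    apply summable_of_hasFiniteSupport
    apply (hfin d).subset
    intro i hi
    simp only [Function.mem_support, coeff_mul_X_pow'] at hi
    simp only [Set.mem_ofPred_eq]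
    by_contra h
    apply hi
    rw [if_neg h]
  exact ⟨PowerSeries.mk fun d => ∑' i, coeff d (a i * X ^ (e i) : PowerSeries ℂ),
    ps_hasSum_iff.2 (fun d => by rw [coeff_mk]; exact (this d).hasSum)⟩

theorem mult_gen (e : ℕ → ℕ) (he : ∀ k, k < e k) (a : ℕ → PowerSeries ℂ) :
    Multipliable (fun k => 1 + a k * X ^ (e k)) := by
  apply multipliable_one_add_of_summable_prod
  have := ps_summable' (fun P : Finset ℕ => ∑ k ∈ P, e k) (fun P => ∏ k ∈ P, a k)
    (fin_finset_sum e he)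
  refine this.congr (fun P => ?_)
  rw [Finset.prod_mul_distrib, Finset.prod_pow_eq_pow_sum]

theorem hasProd_sub (e : ℕ → ℕ) (he : ∀ k, k < e k) :
    HasProd (fun k => (1 - X ^ (e k) : PowerSeries ℂ))
      (∑' P : Finset ℕ, C ((-1 : ℂ) ^ P.card) * X ^ (∑ k ∈ P, e k)) := by
  have h1 : ∀ P : Finset ℕ, ∏ k ∈ P, (-X ^ e k : PowerSeries ℂ) =
      C ((-1 : ℂ) ^ P.card) * X ^ (∑ k ∈ P, e k) := by
    intro P
    rw [Finset.prod_neg, Finset.prod_pow_eq_pow_sum]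
    simp
  have h2 := ps_summable (fun P : Finset ℕ => ∑ k ∈ P, e k) (fun P => (-1 : ℂ) ^ P.card)
    (fun d => (fin_finset_sum e he d).subset (fun P hP => le_of_eq hP))
  have h3 := hasProd_one_add_of_hasSum_prod (f := fun k => (-X ^ e k : PowerSeries ℂ))
    (h2.hasSum.congr_fun (fun P => (h1 P)))
  simpa [sub_eq_add_neg] using h3

theorem mult_sub (e : ℕ → ℕ) (he : ∀ k, k < e k) :
    Multipliable (fun k => (1 - X ^ (e k) : PowerSeries ℂ)) := (hasProd_sub e he).multipliable

theorem pn_prod (s : ℕ) (hs : s ≠ 0) :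
    (∑' n : ℕ, (C (qn n n : ℂ) * X ^ (s * n) : PowerSeries ℂ)) *
      ∏' k : ℕ, (1 - X ^ (s * (k + 1))) = 1 := by
  have hs' := Nat.pos_of_ne_zero hs
  have h1 : ∀ k, k < s * (k + 1) := fun k => by nlinarith
  have h2 := (mult_sub _ h1).hasProd.tendsto_prod_nat
  rw [tsum_expand s hs (fun n => (qn n n : ℂ))]
  have h3 : Filter.Tendsto (fun m => expand s hs (Gn m)) Filter.atTop
      (nhds (expand s hs (mk fun n => (qn n n : ℂ)))) := by
    rw [ps_tendsto_iff]
    intro d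
    apply tendsto_const_nhds.congr'
    filter_upwards [Filter.eventually_ge_atTop d] with m hm
    rw [coeff_expand, coeff_expand]
    split_ifs with h
    · rw [Gn, coeff_mk, coeff_mk, qn_stable m (d / s) ((Nat.div_le_self d s).trans hm)]
    · rfl
  refine tendsto_nhds_unique (h3.mul h2) ?_
  apply tendsto_const_nhds.congr
  intro m
  have h4 := congrArg (expand s hs) (Gn_prod m)
  rw [map_one, map_mul, map_prod] at h4
  refine h4.symm.trans ?_
  congr 1
  apply Finset.prod_congr rfl
  intro k _
  rw [map_sub, map_one, map_pow, expand_X, pow_mul]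

/-- The infinite product. -/
theorem rhs_prod (t' : ℕ) (ht' : 0 < t') :
    ∏' k : ℕ, ((1 - X ^ (k + 1)) * (1 - X ^ (2 * (k + 1)) : PowerSeries ℂ)⁻¹ *
          (1 - X ^ (2 * (k + 1) * (2 * t'))) ^ t') =
    (∏' k : ℕ, (1 - X ^ (2 * k + 1) : PowerSeries ℂ)) *
      (∏' k : ℕ, (1 - X ^ (2 * (2 * t') * (k + 1)) : PowerSeries ℂ)) ^ t' := by
  have m1 := (mult_sub (fun k => 2 * k + 1) (fun k => by omega)).hasProd
  have m2 := (mult_sub (fun k => 2 * (k + 1)) (fun k => by omega)).hasProd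
  have m3 := (mult_sub (fun k => 2 * (2 * t') * (k + 1)) (fun k => by nlinarith)).hasProd
  have hc : ∀ k : ℕ, constantCoeff (1 - X ^ (2 * (k + 1)) : PowerSeries ℂ) ≠ 0 := by
    intro k; simp
  have m4 : Multipliable (fun k => (1 - X ^ (2 * (k + 1)) : PowerSeries ℂ)⁻¹) := by
    have := mult_gen (fun k => 2 * (k + 1)) (fun k => by omega)
      (fun k => (1 - X ^ (2 * (k + 1)) : PowerSeries ℂ)⁻¹)
    refine this.congr (fun k => ?_)
    have := PowerSeries.mul_inv_cancel _ (hc k)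
    linear_combination -this
  have m5 := m4.hasProd
  have m12 : HasProd (fun k => (1 - X ^ (k + 1) : PowerSeries ℂ)) _ :=
    HasProd.even_mul_odd (f := fun k => (1 - X ^ (k + 1) : PowerSeries ℂ)) m1 m2
  have h6 := m2.mul m5
  have h7 : (∏' k : ℕ, (1 - X ^ (2 * (k + 1)) : PowerSeries ℂ)) *
      (∏' k : ℕ, (1 - X ^ (2 * (k + 1)) : PowerSeries ℂ)⁻¹) = 1 := by
    refine h6.unique ?_
    convert hasProd_one with k
    exact PowerSeries.mul_inv_cancel _ (hc k)
  have m3p : HasProd (fun k => (1 - X ^ (2 * (2 * t') * (k + 1)) : PowerSeries ℂ) ^ t') _ :=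
    m3.pow t'
  have h8 := (m12.mul m5).mul m3p
  rw [mul_assoc _ _ (∏' k : ℕ, (1 - X ^ (2 * (k + 1)) : PowerSeries ℂ)⁻¹), h7, mul_one] at h8
  rw [← h8.tprod_eq]
  apply tprod_congr
  intro k
  rw [show 2 * (k + 1) * (2 * t') = 2 * (2 * t') * (k + 1) by ring]

theorem exp_side (t' : ℕ) (ht' : 0 < t') (b : ℂ) :
    (∑' n : ℕ, (C ((-b ^ 2) ^ n / (n.factorial : ℂ)) * X ^ (2 * (2 * t') * n) : PowerSeries ℂ)) ^ t' =
      pexp (- (PowerSeries.C (R := ℂ) (b ^ 2 * (t' : ℂ)) * X ^ (2 * (2 * t')))) := by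
  have hs : 2 * (2 * t') ≠ 0 := by omega
  have h1 : ∀ a : ℂ, (mk fun n => a ^ n / (n.factorial : ℂ)) = rescale a (exp ℂ) := by
    intro a
    ext n
    rw [coeff_mk, coeff_rescale, coeff_exp]
    simp [div_eq_mul_inv]
  rw [tsum_expand _ hs (fun n => (-b ^ 2) ^ n / (n.factorial : ℂ)), ← map_pow, h1, ← map_pow,
    exp_pow_eq_rescale_exp, rescale_rescale, ← h1, ← tsum_expand _ hs]
  unfold pexp
  apply tsum_congr
  intro n
  rw [← neg_mul, mul_pow (-C (b ^ 2 * (t' : ℂ))), ← pow_mul, ← map_neg, ← map_pow,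
    ← mul_assoc (C _) (C _), ← map_mul]
  congr 2
  ring

/-- residue class part of a finset -/
def rcl (t r : ℕ) (P : Finset ℕ) : Finset ℕ := (P.filter (fun p => p % t = r)).image (· / t)

theorem mem_rcl {t r : ℕ} (hr : r < t) {P : Finset ℕ} {k : ℕ} : k ∈ rcl t r P ↔ t * k + r ∈ P := by
  unfold rcl
  simp only [Finset.mem_image, Finset.mem_filter]
  constructor
  · rintro ⟨p, ⟨hp, h1⟩, h2⟩
    rw [← h1, ← h2, Nat.div_add_mod]
    exact hp
  · intro h
    refine ⟨_, ⟨h, ?_⟩, ?_⟩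
    · rw [Nat.mul_add_mod, Nat.mod_eq_of_lt hr]
    · rw [Nat.mul_add_div (by omega), Nat.div_eq_of_lt hr, add_zero]

theorem sum_rcl {M : Type*} [AddCommMonoid M] (t : ℕ) (ht : 0 < t) (P : Finset ℕ) (f : ℕ → M) :
    ∑ p ∈ P, f p = ∑ s ∈ Finset.range t, ∑ k ∈ rcl t s P, f (t * k + s) := by
  rw [← Finset.sum_fiberwise_of_maps_to (s := P) (t := Finset.range t) (g := fun p => p % t)
    (fun p _ => Finset.mem_range.2 (Nat.mod_lt p ht))]
  apply Finset.sum_congr rfl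
  intro s hs
  unfold rcl
  rw [Finset.sum_image]
  · apply Finset.sum_congr rfl
    intro p hp
    rw [Finset.mem_filter] at hp
    rw [← hp.2, Nat.div_add_mod]
  · intro p hp q hq h
    simp only [Finset.coe_filter, Set.mem_ofPred_eq] at hp hq h
    rw [← Nat.div_add_mod p t, ← Nat.div_add_mod q t, h, hp.2, hq.2]

/-- the pair attached to class `r` -/
def pq (t r : ℕ) (P : Finset ℕ) : Finset ℕ × Finset ℕ := (rcl t r P, rcl t (t - 1 - r) P)

theorem sum_fold {M : Type*} [AddCommMonoid M] (t' : ℕ) (g : ℕ → M) :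
    ∑ s ∈ Finset.range (2 * t'), g s = ∑ r : Fin t', (g r + g (2 * t' - 1 - r)) := by
  rw [Finset.sum_add_distrib, ← Finset.sum_range (fun r => g r),
    ← Finset.sum_range (fun r => g (2 * t' - 1 - r)), two_mul, Finset.sum_range_add]
  congr 1
  rw [← Finset.sum_range_reflect]
  apply Finset.sum_congr rfl
  intro r hr
  rw [Finset.mem_range] at hr
  congr 1
  omega

theorem sum_pq {M : Type*} [AddCommMonoid M] (t' : ℕ) (ht' : 0 < t') (P : Finset ℕ) (f : ℕ → M) :
    ∑ p ∈ P, f p = ∑ r : Fin t', (∑ k ∈ (pq (2 * t') r P).1, f (2 * t' * k + r) +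
      ∑ k ∈ (pq (2 * t') r P).2, f (2 * t' * k + (2 * t' - 1 - r))) := by
  rw [sum_rcl (2 * t') (by omega)]
  exact sum_fold t' (fun s => ∑ k ∈ rcl (2 * t') s P, f (2 * t' * k + s))

theorem pq_inj (t' : ℕ) (ht' : 0 < t') (P Q : Finset ℕ)
    (h : ∀ r : Fin t', pq (2 * t') r P = pq (2 * t') r Q) : P = Q := by
  have h1 : ∀ s < 2 * t', rcl (2 * t') s P = rcl (2 * t') s Q := by
    intro s hs
    by_cases h' : s < t'
    · exact congrArg Prod.fst (h ⟨s, h'⟩)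
    · have := congrArg Prod.snd (h ⟨2 * t' - 1 - s, by omega⟩)
      simp only [pq] at this
      rwa [show 2 * t' - 1 - (2 * t' - 1 - s) = s by omega] at this
  ext p
  have h2 : p % (2 * t') < 2 * t' := Nat.mod_lt _ (by omega)
  rw [← Nat.div_add_mod p (2 * t'), ← mem_rcl h2, ← mem_rcl h2, h1 _ h2]

theorem pq_surj (t' : ℕ) (g : Fin t' → Finset ℕ × Finset ℕ) :
    ∃ P : Finset ℕ, ∀ r : Fin t', pq (2 * t') r P = g r := by
  let P : Finset ℕ := Finset.univ.biUnion (fun r : Fin t' =>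
    (g r).1.image (fun k => 2 * t' * k + r) ∪ (g r).2.image (fun k => 2 * t' * k + (2 * t' - 1 - r)))
  have hP : ∀ p, p ∈ P ↔ ∃ r : Fin t', (∃ k ∈ (g r).1, 2 * t' * k + r = p) ∨
      (∃ k ∈ (g r).2, 2 * t' * k + (2 * t' - 1 - r) = p) := by
    intro p
    simp [P]
  have huniq : ∀ a b k l : ℕ, a < 2 * t' → b < 2 * t' → 2 * t' * k + a = 2 * t' * l + b →
      k = l ∧ a = b := by
    intro a b k l ha hb h
    have h1 := congrArg (· % (2 * t')) h
    have h2 := congrArg (· / (2 * t')) h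
    simp only [Nat.mul_add_mod, Nat.mod_eq_of_lt ha, Nat.mod_eq_of_lt hb] at h1
    simp only [Nat.mul_add_div (show 2 * t' > 0 by omega), Nat.div_eq_of_lt ha,
      Nat.div_eq_of_lt hb] at h2
    omega
  refine ⟨P, fun r => ?_⟩
  have hr := r.2
  unfold pq
  apply Prod.ext
  · ext k
    simp only
    rw [mem_rcl (by omega), hP]
    constructor
    · rintro ⟨r', ⟨l, hl, h⟩ | ⟨l, hl, h⟩⟩
      · have := huniq _ _ _ _ (by omega) (by omega) h
        rw [← this.1, ← Fin.ext this.2]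
        exact hl
      · have := huniq _ _ _ _ (by omega) (by omega) h
        omega
    · intro h
      exact ⟨r, Or.inl ⟨k, h, rfl⟩⟩
  · ext k
    simp only
    rw [mem_rcl (by omega), hP]
    constructor
    · rintro ⟨r', ⟨l, hl, h⟩ | ⟨l, hl, h⟩⟩
      · have := huniq _ _ _ _ (by omega) (by omega) h
        omega
      · have := huniq _ _ _ _ (by omega) (by omega) h
        have h3 : r' = r := Fin.ext (by omega)
        rw [← this.1, ← h3]
        exact hl
    · intro h
      exact ⟨r, Or.inr ⟨k, h, rfl⟩⟩

theorem tsum_split (t' : ℕ) (ht' : 0 < t') (w : Finset ℕ × Finset ℕ → ℂ) :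
    ∑' P : Finset ℕ, (C ((-1) ^ P.card * ∏ r : Fin t', w (pq (2 * t') r P)) *
      X ^ (∑ p ∈ P, (2 * p + 1)) : PowerSeries ℂ) =
    ∏ r : Fin t', ∑' p : Finset ℕ × Finset ℕ,
      (C ((-1) ^ (p.1.card + p.2.card) * w p) * X ^ (er (2 * t') r p) : PowerSeries ℂ) := by
  rw [prod_tsum (fun r : Fin t' => er (2 * t') r)
    (fun _ p => (-1) ^ (p.1.card + p.2.card) * w p) (fun r => er_fin (2 * t') r (by omega))]
  let E : Finset ℕ ≃ (Fin t' → Finset ℕ × Finset ℕ) :=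
    Equiv.ofBijective (fun P r => pq (2 * t') r P)
      ⟨fun P Q h => pq_inj t' ht' P Q (fun r => congrFun h r),
       fun g => (pq_surj t' g).imp (fun P h => funext h)⟩
  rw [← E.tsum_eq]
  apply tsum_congr
  intro P
  have h1 : ∀ r, E P r = pq (2 * t') r P := fun r => rfl
  simp only [h1]
  congr 2
  · rw [Finset.prod_mul_distrib, Finset.prod_pow_eq_pow_sum, Finset.card_eq_sum_ones,
      sum_pq t' ht' P]
    simp
  · rw [sum_pq t' ht' P]
    rfl

/-- The core identity. -/
theorem core (t' : ℕ) (ht' : 0 < t') (b : ℂ) :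
    ∑' P : Finset ℕ, (C ((-1) ^ P.card * ∏ r : Fin t', wt (fun h : ℤ => -(b / (h : ℂ)) ^ 2)
        (beadset (pq (2 * t') r P).1 (pq (2 * t') r P).2)) *
      X ^ (∑ p ∈ P, (2 * p + 1)) : PowerSeries ℂ) =
    pexp (- (PowerSeries.C (R := ℂ) (b ^ 2 * (t' : ℂ)) * X ^ (2 * (2 * t')))) *
      ∏' k : ℕ,
        ((1 - X ^ (k + 1)) * (1 - X ^ (2 * (k + 1)) : PowerSeries ℂ)⁻¹ *
          (1 - X ^ (2 * (k + 1) * (2 * t'))) ^ t') := by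
  have h1 := tsum_split t' ht' (fun p => wt (fun h : ℤ => -(b / (h : ℂ)) ^ 2) (beadset p.1 p.2))
  have h2 := tsum_split t' ht' (fun p => 1)
  rw [h1, Finset.prod_congr rfl (fun (r : Fin t') _ => fiber_sum (2 * t') r (by omega) _ _ (sum_fibF_hook b)),
    Finset.prod_mul_distrib, Finset.prod_const, Finset.card_univ, Fintype.card_fin, exp_side t' ht']
  have h3 : ∀ c n, ∑ p ∈ fibF c n, (1 : ℂ) = (qn n n : ℂ) := by
    intro c n
    rw [sum_fibF (w := fun _ => (1 : ℂ)), ← qn_stable (cm c n) n (cm_ge c n).1]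
    simp [qn]
  rw [Finset.prod_congr rfl (fun (r : Fin t') _ => fiber_sum (2 * t') r (by omega) _ _ h3),
    Finset.prod_mul_distrib, Finset.prod_const, Finset.card_univ, Fintype.card_fin, Finset.prod_const, Finset.card_univ, Fintype.card_fin] at h2
  have h4 := (hasProd_sub (fun k => 2 * k + 1) (fun k => by omega)).tprod_eq
  simp only [one_pow, mul_one] at h2
  rw [rhs_prod t' ht', h4, h2, mul_assoc _ _ (_ ^ t'), ← mul_pow, pn_prod _ (by omega), one_pow]
  ring

/-- bead of row `i` -/
def bd (μ : YoungDiagram) (i : ℕ) : ℤ := (μ.rowLen i : ℤ) - i - 1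
/-- gap of column `j` -/
def gp (μ : YoungDiagram) (j : ℕ) : ℤ := (j : ℤ) - μ.colLen j

theorem bd_anti (μ : YoungDiagram) {i j : ℕ} (h : i < j) : bd μ j < bd μ i := by
  have := μ.rowLen_anti i j h.le
  unfold bd
  omega

theorem gp_mono (μ : YoungDiagram) {i j : ℕ} (h : i < j) : gp μ i < gp μ j := by
  have := μ.colLen_anti i j h.le
  unfold gp
  omega

theorem bd_inj (μ : YoungDiagram) {i j : ℕ} (h : bd μ i = bd μ j) : i = j := by
  rcases lt_trichotomy i j with h' | h' | h'
  · have := bd_anti μ h'; omega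
  · exact h'
  · have := bd_anti μ h'; omega

theorem gp_inj (μ : YoungDiagram) {i j : ℕ} (h : gp μ i = gp μ j) : i = j := by
  rcases lt_trichotomy i j with h' | h' | h'
  · have := gp_mono μ h'; omega
  · exact h'
  · have := gp_mono μ h'; omega

theorem gp_lt_bd (μ : YoungDiagram) {i j : ℕ} (h : (i, j) ∈ μ) : gp μ j < bd μ i := by
  have h1 := YoungDiagram.mem_iff_lt_rowLen.1 h
  have h2 := YoungDiagram.mem_iff_lt_colLen.1 h
  unfold bd gp
  omega

theorem bd_lt_gp (μ : YoungDiagram) {i j : ℕ} (h : (i, j) ∉ μ) : bd μ i < gp μ j := by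
  have h1 := mt YoungDiagram.mem_iff_lt_rowLen.2 h
  have h2 := mt YoungDiagram.mem_iff_lt_colLen.2 h
  unfold bd gp
  omega

theorem hook_eq (μ : YoungDiagram) {c : ℕ × ℕ} (h : c ∈ μ) :
    (hookLen μ c : ℤ) = bd μ c.1 - gp μ c.2 := by
  have h1 := YoungDiagram.mem_iff_lt_rowLen.1 (show (c.1, c.2) ∈ μ from h)
  have h2 := YoungDiagram.mem_iff_lt_colLen.1 (show (c.1, c.2) ∈ μ from h)
  unfold hookLen bd gp
  omega

theorem cover (μ : YoungDiagram) (z : ℤ) : (∃ i, z = bd μ i) ∨ (∃ j, z = gp μ j) := by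
  have hex : ∃ n : ℕ, ((-z).toNat + n, z.toNat + n) ∉ μ := by
    refine ⟨μ.colLen 0, fun h => ?_⟩
    have h1 := YoungDiagram.mem_iff_lt_colLen.1 h
    have h2 := μ.colLen_anti 0 (z.toNat + μ.colLen 0) (Nat.zero_le _)
    omega
  classical
  have hn := Nat.find_spec hex
  have hmin : ∀ m, m < Nat.find hex → ((-z).toNat + m, z.toNat + m) ∈ μ := fun m hm => by
    simpa using Nat.find_min hex hm
  generalize Nat.find hex = n at hn hmin
  have h1 := mt YoungDiagram.mem_iff_lt_rowLen.2 hn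
  have h2 := mt YoungDiagram.mem_iff_lt_colLen.2 hn
  by_cases h3 : μ.colLen (z.toNat + n) = (-z).toNat + n
  · right
    refine ⟨z.toNat + n, ?_⟩
    unfold gp
    omega
  · left
    refine ⟨(-z).toNat + n - 1, ?_⟩
    have h4 : ((-z).toNat + n - 1, z.toNat + n) ∉ μ := fun h => by
      have := YoungDiagram.mem_iff_lt_colLen.1 h
      omega
    have h5 := mt YoungDiagram.mem_iff_lt_rowLen.2 h4
    have h6 : z.toNat + n ≤ μ.rowLen ((-z).toNat + n - 1) := by
      rcases Nat.eq_zero_or_pos n with hn0 | hn0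
      · by_cases hz : 0 ≤ z
        · omega
        · omega
      · have := YoungDiagram.mem_iff_lt_rowLen.1 (hmin (n - 1) (by omega))
        rw [show (-z).toNat + (n - 1) = (-z).toNat + n - 1 by omega] at this
        omega
    unfold bd
    omega

/-- bead set -/
def SS (μ : YoungDiagram) : Set ℤ := {z | ∃ i, z = bd μ i}

theorem notMem_SS (μ : YoungDiagram) (z : ℤ) : z ∉ SS μ ↔ ∃ j, z = gp μ j := by
  constructor
  · intro h
    exact (cover μ z).resolve_left h
  · rintro ⟨j, hj⟩ ⟨i, hi⟩
    by_cases h : (i, j) ∈ μ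
    · have := gp_lt_bd μ h; omega
    · have := bd_lt_gp μ h; omega

theorem mem_hks_SS (μ : YoungDiagram) (p : ℤ × ℤ) :
    p ∈ hks (SS μ) ↔ ∃ c ∈ μ.cells, (bd μ c.1, gp μ c.2) = p := by
  unfold hks
  simp only [Set.mem_ofPred_eq, notMem_SS]
  constructor
  · rintro ⟨⟨i, hi⟩, ⟨j, hj⟩, h⟩
    refine ⟨(i, j), ?_, Prod.ext hi.symm hj.symm⟩
    rw [YoungDiagram.mem_cells]
    by_contra h'
    have := bd_lt_gp μ h'
    omega
  · rintro ⟨c, hc, rfl⟩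
    exact ⟨⟨_, rfl⟩, ⟨_, rfl⟩, gp_lt_bd μ hc⟩

/-- diagonal arm lengths -/
def PP (μ : YoungDiagram) : Finset ℕ :=
  (μ.cells.filter fun c => c.1 = c.2).image (fun c => μ.rowLen c.1 - c.1 - 1)

theorem card_PP (μ : YoungDiagram) : (PP μ).card = durfee μ := by
  unfold PP durfee
  apply Finset.card_image_of_injOn
  rintro ⟨i, j⟩ hc ⟨k, l⟩ hd h
  simp only [Finset.coe_filter, Set.mem_ofPred_eq, YoungDiagram.mem_cells] at hc hd h
  obtain ⟨hc, rfl⟩ := hc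
  obtain ⟨hd, rfl⟩ := hd
  have h1 := YoungDiagram.mem_iff_lt_rowLen.1 hc
  have h2 := YoungDiagram.mem_iff_lt_rowLen.1 hd
  have : i = k := bd_inj μ (by unfold bd; omega)
  rw [this]

theorem mem_PP (μ : YoungDiagram) (p : ℕ) : p ∈ PP μ ↔ ∃ i, (p : ℤ) = bd μ i := by
  unfold PP
  simp only [Finset.mem_image, Finset.mem_filter, YoungDiagram.mem_cells]
  constructor
  · rintro ⟨⟨i, j⟩, ⟨hc, h⟩, rfl⟩
    simp only at h
    subst h
    have h1 := YoungDiagram.mem_iff_lt_rowLen.1 hc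
    refine ⟨i, ?_⟩
    unfold bd
    simp only
    omega
  · rintro ⟨i, hi⟩
    unfold bd at hi
    refine ⟨(i, i), ⟨YoungDiagram.mem_iff_lt_rowLen.2 (by omega), rfl⟩, ?_⟩
    simp only
    omega

theorem sc_gp {μ : YoungDiagram} (h : μ.transpose = μ) (j : ℕ) : gp μ j = -1 - bd μ j := by
  have : μ.colLen j = μ.rowLen j := by
    rw [← μ.rowLen_transpose, h]
  unfold gp bd
  omega

theorem SS_eq {μ : YoungDiagram} (h : μ.transpose = μ) : SS μ = beadset (PP μ) (PP μ) := by
  ext z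
  unfold beadset
  simp only [Set.mem_ofPred_eq, mem_PP]
  rcases le_or_gt 0 z with hz | hz
  · rw [Int.toNat_of_nonneg hz]
    simp only [SS, Set.mem_ofPred_eq, hz, true_and]
    constructor
    · exact Or.inl
    · rintro (h | h)
      · exact h
      · omega
  · rw [Int.toNat_of_nonneg (show 0 ≤ -1 - z by omega)]
    have h1 := notMem_SS μ z
    simp only [sc_gp h] at h1
    rw [← not_iff_not, h1]
    constructor
    · rintro ⟨j, hj⟩ (h | h)
      · omega
      · exact h.2 ⟨j, by omega⟩
    · intro h
      push Not at h
      obtain ⟨i, hi⟩ := h.2 hz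
      exact ⟨i, by omega⟩

theorem prod_cells {M : Type*} [CommMonoid M] (μ : YoungDiagram) (F : ℤ × ℤ → M) :
    ∏ c ∈ μ.cells, F (bd μ c.1, gp μ c.2) = ∏ᶠ p ∈ hks (SS μ), F p := by
  rw [← finprod_mem_coe_finset]
  apply finprod_mem_eq_of_bijOn (fun c => (bd μ c.1, gp μ c.2))
  · refine ⟨?_, ?_, ?_⟩
    · intro c hc
      exact (mem_hks_SS μ _).2 ⟨c, hc, rfl⟩
    · intro c _ d _ h
      have := Prod.ext_iff.1 h
      exact Prod.ext (bd_inj μ this.1) (gp_inj μ this.2)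
    · intro p hp
      obtain ⟨c, hc, h⟩ := (mem_hks_SS μ _).1 hp
      exact ⟨c, hc, h⟩
  · intro c _
    rfl

theorem card_sc {μ : YoungDiagram} (h : μ.transpose = μ) : μ.card = ∑ p ∈ PP μ, (2 * p + 1) := by
  have h1 := prod_cells μ (fun _ => 2)
  rw [SS_eq h] at h1
  have h2 := wt_eq (fun _ => 2) ((PP μ).sup id + 1) (PP μ, PP μ) (sub_range_sup _)
  unfold wt at h2
  rw [h2] at h1
  have h3 := nhk_toX ((PP μ).sup id + 1) (PP μ, PP μ) (sub_range_sup _)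
  have h4 : ((μ.card : ℕ) : ℤ) = nhk (toX ((PP μ).sup id + 1) (PP μ, PP μ)) := by
    simp only [Finset.prod_const, Finset.prod_pow_eq_pow_sum] at h1
    exact_mod_cast Nat.pow_right_injective (le_refl 2) h1
  have h5 : chg (PP μ, PP μ) = 0 := by simp [chg]
  rw [h5] at h3
  zify
  rw [h4]
  simp only [Finset.sum_add_distrib, ← Finset.mul_sum, Finset.sum_const] at h3 ⊢
  simp only [nsmul_eq_mul, mul_one]
  linarith

theorem PP_inj {μ ν : YoungDiagram} (hμ : μ.transpose = μ) (hν : ν.transpose = ν)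
    (h : PP μ = PP ν) : μ = ν := by
  have h1 : SS μ = SS ν := by rw [SS_eq hμ, SS_eq hν, h]
  have h2 : (fun i => - bd μ i) = (fun i => - bd ν i) := by
    rw [← StrictMono.range_inj]
    · ext z
      have := Set.ext_iff.1 h1 (-z)
      simp only [SS, Set.mem_ofPred_eq] at this
      simp only [Set.mem_range]
      constructor
      · rintro ⟨i, hi⟩
        obtain ⟨j, hj⟩ := this.1 ⟨i, by omega⟩
        exact ⟨j, by omega⟩
      · rintro ⟨i, hi⟩
        obtain ⟨j, hj⟩ := this.2 ⟨i, by omega⟩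
        exact ⟨j, by omega⟩
    · intro i j hij
      have := bd_anti μ hij
      simp only
      omega
    · intro i j hij
      have := bd_anti ν hij
      simp only
      omega
  have h3 : ∀ i, μ.rowLen i = ν.rowLen i := by
    intro i
    have := congrFun h2 i
    simp only [bd] at this
    omega
  ext ⟨i, j⟩
  rw [YoungDiagram.mem_cells, YoungDiagram.mem_cells, YoungDiagram.mem_iff_lt_rowLen,
    YoungDiagram.mem_iff_lt_rowLen, h3]

/-- membership condition -/
def AA (P : Finset ℕ) (m M : ℕ) : Prop := m < (P.filter (fun p => M ≤ p + m)).card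

theorem AA_step {P : Finset ℕ} {m M : ℕ} (h : AA P (m + 1) M) : AA P m M := by
  unfold AA at *
  have h1 : P.filter (fun p => M ≤ p + (m + 1)) ⊆
      insert (M - (m + 1)) (P.filter (fun p => M ≤ p + m)) := by
    intro p hp
    simp only [Finset.mem_insert, Finset.mem_filter] at hp ⊢
    by_cases h' : M ≤ p + m
    · exact Or.inr ⟨hp.1, h'⟩
    · left; omega
  have h2 := (Finset.card_le_card h1).trans (Finset.card_insert_le _ _)
  omega

theorem AA_anti {P : Finset ℕ} {m M m' M' : ℕ} (hm : m' ≤ m) (hM : M' ≤ M) (h : AA P m M) :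
    AA P m' M' := by
  have h1 : AA P m' M := by
    clear hM
    induction m, hm using Nat.le_induction with
    | base => exact h
    | succ k hk ih => exact ih (AA_step h)
  unfold AA at *
  refine h1.trans_le (Finset.card_le_card ?_)
  intro p hp
  simp only [Finset.mem_filter] at hp ⊢
  exact ⟨hp.1, by omega⟩

theorem AA_bound {P : Finset ℕ} {m M : ℕ} (h : AA P m M) : m < P.card ∧ M ≤ P.sup id + P.card := by
  have h1 : m < P.card := lt_of_lt_of_le h (Finset.card_filter_le _ _)
  refine ⟨h1, ?_⟩
  have h2 : 0 < (P.filter (fun p => M ≤ p + m)).card := lt_of_le_of_lt (Nat.zero_le _) h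
  obtain ⟨p, hp⟩ := Finset.card_pos.1 h2
  rw [Finset.mem_filter] at hp
  have : p ≤ P.sup id := Finset.le_sup (f := id) hp.1
  omega

open Classical in
/-- The self-conjugate diagram of `P`. -/
def YY (P : Finset ℕ) : YoungDiagram where
  cells := (Finset.range (P.sup id + P.card + 1) ×ˢ Finset.range (P.sup id + P.card + 1)).filter
    (fun c => AA P (min c.1 c.2) (max c.1 c.2))
  isLowerSet := by
    intro c d hdc hc
    have h1 : d.1 ≤ c.1 := hdc.1
    have h2 : d.2 ≤ c.2 := hdc.2
    simp only [Finset.coe_filter, Finset.mem_product, Finset.mem_range, Set.mem_ofPred_eq] at hc ⊢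
    exact ⟨by omega, AA_anti (min_le_min h1 h2) (max_le_max h1 h2) hc.2⟩

theorem mem_YY (P : Finset ℕ) (i j : ℕ) : (i, j) ∈ YY P ↔ AA P (min i j) (max i j) := by
  rw [← YoungDiagram.mem_cells]
  unfold YY
  simp only [Finset.mem_filter, Finset.mem_product, Finset.mem_range, and_iff_right_iff_imp]
  intro h
  have := AA_bound h
  omega

theorem YY_sc (P : Finset ℕ) : (YY P).transpose = YY P := by
  ext ⟨i, j⟩
  rw [YoungDiagram.mem_cells, YoungDiagram.mem_cells, YoungDiagram.mem_transpose]
  simp only [Prod.swap_prod_mk]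
  rw [mem_YY, mem_YY, min_comm, max_comm]

theorem PP_YY (P : Finset ℕ) : PP (YY P) = P := by
  ext p
  rw [mem_PP]
  have h1 : ∀ i, (p : ℤ) = bd (YY P) i ↔ (i, p + i) ∈ YY P ∧ (i, p + 1 + i) ∉ YY P := by
    intro i
    rw [YoungDiagram.mem_iff_lt_rowLen, YoungDiagram.mem_iff_lt_rowLen]
    unfold bd
    omega
  simp only [h1, mem_YY, AA]
  have h2 : ∀ i q : ℕ, min i (q + i) = i ∧ max i (q + i) = q + i := by intro i q; omega
  simp only [(h2 _ _).1, (h2 _ _).2, Nat.add_le_add_iff_right, not_lt]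
  constructor
  · rintro ⟨i, h3, h4⟩
    by_contra hp
    have : P.filter (fun q => p ≤ q) = P.filter (fun q => p + 1 ≤ q) := by
      apply Finset.filter_congr
      intro q hq
      have : q ≠ p := fun h => hp (h ▸ hq)
      omega
    rw [this] at h3
    omega
  · intro hp
    refine ⟨_, ?_, le_refl _⟩
    apply Finset.card_lt_card
    rw [Finset.ssubset_iff_of_subset]
    · exact ⟨p, by simp [hp], by simp⟩
    · intro q hq
      simp only [Finset.mem_filter] at hq ⊢
      exact ⟨hq.1, by omega⟩

/-- bijection -/
def scE : {μ : YoungDiagram // μ.transpose = μ} ≃ Finset ℕ :=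
  Equiv.ofBijective (fun μ => PP μ.1)
    ⟨fun μ ν h => Subtype.ext (PP_inj μ.2 ν.2 h), fun P => ⟨⟨YY P, YY_sc P⟩, PP_YY P⟩⟩

theorem swap_mem {μ : YoungDiagram} (h : μ.transpose = μ) {c : ℕ × ℕ} (hc : c ∈ μ) : c.swap ∈ μ := by
  rw [← h] at hc
  exact YoungDiagram.mem_transpose.1 hc

theorem hook_swap {μ : YoungDiagram} (h : μ.transpose = μ) {c : ℕ × ℕ} (hc : c ∈ μ) :
    hookLen μ c.swap = hookLen μ c := by
  zify
  rw [hook_eq μ hc, hook_eq μ (swap_mem h hc), sc_gp h, sc_gp h]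
  simp only [Prod.fst_swap, Prod.snd_swap]
  ring

/-- residue class of a cell -/
def cls (μ : YoungDiagram) (t : ℕ) (c : ℕ × ℕ) : ℕ := (bd μ c.1 % (t : ℤ)).toNat

theorem cls_spec (μ : YoungDiagram) (t : ℕ) (ht : 0 < t) (c : ℕ × ℕ) :
    cls μ t c < t ∧ ∃ a : ℤ, bd μ c.1 = t * a + cls μ t c := by
  unfold cls
  have h1 := Int.emod_nonneg (bd μ c.1) (show (t : ℤ) ≠ 0 by omega)
  have h2 := Int.emod_lt_of_pos (bd μ c.1) (show (0 : ℤ) < t by omega)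
  refine ⟨by omega, bd μ c.1 / t, ?_⟩
  rw [Int.toNat_of_nonneg h1, Int.mul_ediv_add_emod]

theorem cls_unique (μ : YoungDiagram) (t r : ℕ) (hr : r < t) (c : ℕ × ℕ) (a : ℤ)
    (h : bd μ c.1 = t * a + r) : cls μ t c = r := by
  unfold cls
  rw [h, Int.mul_add_emod_self_left, Int.emod_eq_of_lt (by omega) (by omega)]
  simp

theorem cls_swap {μ : YoungDiagram} (h : μ.transpose = μ) (t : ℕ) (ht : 0 < t) {c : ℕ × ℕ}
    (hc : c ∈ μ) (hd : t ∣ hookLen μ c) : cls μ t c.swap = t - 1 - cls μ t c := by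
  obtain ⟨h1, a, h2⟩ := cls_spec μ t ht c
  have h3 := hook_eq μ hc
  obtain ⟨k, hk⟩ := hd
  rw [hk, sc_gp h] at h3
  apply cls_unique μ t _ (by omega) _ (k - a - 1)
  simp only [Prod.fst_swap]
  have h4 : ((t - 1 - cls μ t c : ℕ) : ℤ) = t - 1 - cls μ t c := by omega
  rw [h4]
  push_cast at h3
  linear_combination (-1) * h3 - h2

theorem mem_beadset_rcl (t r : ℕ) (hr : r < t) (P : Finset ℕ) (a : ℤ) :
    a ∈ beadset (pq t r P).1 (pq t r P).2 ↔ (t : ℤ) * a + r ∈ beadset P P := by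
  unfold beadset pq
  simp only [Set.mem_ofPred_eq]
  rw [mem_rcl hr, mem_rcl (show t - 1 - r < t by omega)]
  rcases le_or_gt 0 a with ha | ha
  · obtain ⟨k, rfl⟩ := Int.eq_ofNat_of_zero_le ha
    have h1 : (0 : ℤ) ≤ t * (k : ℤ) + r := by positivity
    have h2 : ((t : ℤ) * (k : ℤ) + r).toNat = t * k + r := by
      zify; rw [Int.toNat_of_nonneg h1]
    rw [h2]
    simp [h1.not_gt, h1]
  · obtain ⟨k, rfl⟩ : ∃ k : ℕ, a = -1 - k := ⟨(-1 - a).toNat, by omega⟩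
    have h0 : ((t - 1 - r : ℕ) : ℤ) = t - 1 - r := by omega
    have h3 : (0 : ℤ) ≤ t * (k : ℤ) := by positivity
    have h1 : (t : ℤ) * (-1 - k) + r < 0 := by nlinarith
    have h2 : (-1 - ((t : ℤ) * (-1 - k) + r)).toNat = t * k + (t - 1 - r) := by
      zify; rw [Int.toNat_of_nonneg (by omega), h0]; ring
    rw [h2]
    simp only [h1.not_ge, h1, ha.not_ge, ha, false_and, true_and, false_or]
    rw [show (-1 - (-1 - (k : ℤ))).toNat = k by omega]

theorem prod_class {μ : YoungDiagram} (h : μ.transpose = μ) (t r : ℕ) (hr : r < t) (b : ℂ) :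
    ∏ c ∈ (μ.cells.filter (fun c => t ∣ hookLen μ c)).filter (fun c => cls μ t c = r),
      (-(b * t / (hookLen μ c : ℂ)) ^ 2) =
    wt (fun h : ℤ => -(b / (h : ℂ)) ^ 2) (beadset (pq t r (PP μ)).1 (pq t r (PP μ)).2) := by
  have ht : 0 < t := by omega
  have htz : (0 : ℤ) < t := by omega
  unfold wt
  rw [← finprod_mem_coe_finset]
  have key : ∀ c ∈ (μ.cells.filter (fun c => t ∣ hookLen μ c)).filter (fun c => cls μ t c = r),
      ∃ p : ℤ × ℤ, bd μ c.1 = t * p.1 + r ∧ gp μ c.2 = t * p.2 + r ∧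
        bd μ c.1 / t = p.1 ∧ gp μ c.2 / t = p.2 := by
    intro c hc
    simp only [Finset.mem_filter, YoungDiagram.mem_cells] at hc
    obtain ⟨⟨hc, k, hk⟩, hr'⟩ := hc
    obtain ⟨-, a, h2⟩ := cls_spec μ t ht c
    have h3 := hook_eq μ hc
    rw [hr'] at h2
    rw [hk] at h3
    push_cast at h3
    have h4 : gp μ c.2 = t * (a - k) + r := by linear_combination h3 + h2
    refine ⟨(a, a - k), h2, h4, ?_, ?_⟩
    · rw [h2, Int.mul_add_ediv_left _ _ htz.ne', Int.ediv_eq_zero_of_lt (by omega) (by omega), add_zero]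
    · rw [h4, Int.mul_add_ediv_left _ _ htz.ne', Int.ediv_eq_zero_of_lt (by omega) (by omega), add_zero]
  apply finprod_mem_eq_of_bijOn (fun c => (bd μ c.1 / (t : ℤ), gp μ c.2 / (t : ℤ)))
  · refine ⟨?_, ?_, ?_⟩
    · intro c hc
      obtain ⟨p, h1, h2, h3, h4⟩ := key c hc
      simp only [Finset.coe_filter, Finset.mem_filter, Set.mem_ofPred_eq] at hc
      have h5 := (mem_hks_SS μ _).2 ⟨c, hc.1.1, rfl⟩
      rw [SS_eq h] at h5
      unfold hks at h5 ⊢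
      simp only [Set.mem_ofPred_eq, mem_beadset_rcl t r hr, h3, h4, ← h1, ← h2] at h5 ⊢
      refine ⟨h5.1, h5.2.1, ?_⟩
      rw [h1, h2] at h5
      nlinarith [h5.2.2]
    · intro c hc d hd hcd
      obtain ⟨p, h1, h2, h3, h4⟩ := key c hc
      obtain ⟨q, k1, k2, k3, k4⟩ := key d hd
      have := Prod.ext_iff.1 hcd
      simp only [h3, h4, k3, k4] at this
      refine Prod.ext (bd_inj μ ?_) (gp_inj μ ?_)
      · rw [h1, k1, this.1]
      · rw [h2, k2, this.2]
    · intro p hp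
      have h5 : ((t : ℤ) * p.1 + r, (t : ℤ) * p.2 + r) ∈ hks (SS μ) := by
        rw [SS_eq h]
        unfold hks at hp ⊢
        simp only [Set.mem_ofPred_eq, mem_beadset_rcl t r hr] at hp ⊢
        refine ⟨hp.1, hp.2.1, ?_⟩
        have := mul_lt_mul_of_pos_left hp.2.2 htz
        omega
      obtain ⟨c, hc, h6⟩ := (mem_hks_SS μ _).1 h5
      have h7 := Prod.ext_iff.1 h6
      simp only at h7
      have h8 : c ∈ (μ.cells.filter (fun c => t ∣ hookLen μ c)).filter (fun c => cls μ t c = r) := by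
        simp only [Finset.mem_filter]
        refine ⟨⟨hc, ?_⟩, cls_unique μ t r hr c p.1 h7.1⟩
        have h9 := hook_eq μ hc
        rw [h7.1, h7.2] at h9
        have : (t : ℤ) ∣ hookLen μ c := ⟨p.1 - p.2, by rw [h9]; ring⟩
        exact_mod_cast this
      refine ⟨c, h8, ?_⟩
      obtain ⟨q, k1, k2, k3, k4⟩ := key c h8
      simp only [k3, k4]
      rw [h7.1] at k1
      rw [h7.2] at k2
      refine Prod.ext ?_ ?_
      · exact (mul_left_cancel₀ htz.ne' (add_right_cancel k1)).symm
      · exact (mul_left_cancel₀ htz.ne' (add_right_cancel k2)).symm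
  · intro c hc
    obtain ⟨p, h1, h2, h3, h4⟩ := key c hc
    simp only [Finset.coe_filter, Finset.mem_filter, Set.mem_ofPred_eq] at hc
    have h9 := hook_eq μ hc.1.1
    have h10 : ((hookLen μ c : ℤ) : ℂ) = t * ((p.1 - p.2 : ℤ) : ℂ) := by
      rw [h9, h1, h2]
      push_cast
      ring
    simp only [h3, h4]
    have h11 : (t : ℂ) ≠ 0 := by exact_mod_cast ht.ne'
    rw [Int.cast_natCast] at h10
    rw [h10, mul_comm b, mul_div_mul_left _ _ h11]

theorem prod_hooks {μ : YoungDiagram} (h : μ.transpose = μ) (t' : ℕ) (ht' : 0 < t') (b : ℂ) :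
    ∏ c ∈ μ.cells.filter (fun c => (2 * t') ∣ hookLen μ c),
          (b * (2 * t' : ℕ) / ((hookLen μ c : ℂ) * eps c)) =
    ∏ r : Fin t', wt (fun h : ℤ => -(b / (h : ℂ)) ^ 2)
        (beadset (pq (2 * t') r (PP μ)).1 (pq (2 * t') r (PP μ)).2) := by
  have ht : 0 < 2 * t' := by omega
  rw [Finset.prod_congr rfl (fun (r : Fin t') _ => (prod_class h (2 * t') r (by omega) b).symm)]
  set T := μ.cells.filter (fun c => (2 * t') ∣ hookLen μ c) with hT
  have hmem : ∀ c, c ∈ T ↔ c ∈ μ ∧ 2 * t' ∣ hookLen μ c := by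
    intro c; rw [hT, Finset.mem_filter, YoungDiagram.mem_cells]
  rw [← Finset.prod_range (fun r => ∏ c ∈ T.filter (fun c => cls μ (2 * t') c = r),
    (-(b * (2 * t' : ℕ) / (hookLen μ c : ℂ)) ^ 2))]
  have e1 : ∀ r ∈ Finset.range t', T.filter (fun c => cls μ (2 * t') c = r) =
      (T.filter (fun c => cls μ (2 * t') c < t')).filter (fun c => cls μ (2 * t') c = r) := by
    intro r hr
    rw [Finset.mem_range] at hr
    ext c
    simp only [Finset.mem_filter]
    constructor
    · rintro ⟨h1, h2⟩; exact ⟨⟨h1, by omega⟩, h2⟩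
    · rintro ⟨h1, h2⟩; exact ⟨h1.1, h2⟩
  rw [Finset.prod_congr (s₁ := Finset.range t') rfl (fun r hr => Finset.prod_congr (e1 r hr) (fun _ _ => rfl)),
    Finset.prod_fiberwise_of_maps_to (fun c hc => Finset.mem_range.2 (Finset.mem_filter.1 hc).2),
    ← Finset.prod_filter_mul_prod_filter_not T (fun c => cls μ (2 * t') c < t')]
  have hsw : ∀ c ∈ T, c.swap ∈ T ∧ cls μ (2 * t') c.swap = 2 * t' - 1 - cls μ (2 * t') c := by
    intro c hc
    rw [hmem] at hc
    refine ⟨?_, cls_swap h _ ht hc.1 hc.2⟩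
    rw [hmem, hook_swap h hc.1]
    exact ⟨swap_mem h hc.1, hc.2⟩
  have e2 : ∏ c ∈ T.filter (fun c => ¬ cls μ (2 * t') c < t'),
      (b * (2 * t' : ℕ) / ((hookLen μ c : ℂ) * eps c)) =
      ∏ c ∈ T.filter (fun c => cls μ (2 * t') c < t'),
      (b * (2 * t' : ℕ) / ((hookLen μ c : ℂ) * eps c.swap)) := by
    apply Finset.prod_nbij' Prod.swap Prod.swap
    · intro c hc
      rw [Finset.mem_filter] at hc ⊢
      have := hsw c hc.1
      have := (cls_spec μ _ ht c).1
      exact ⟨(hsw c hc.1).1, by omega⟩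
    · intro c hc
      rw [Finset.mem_filter] at hc ⊢
      have := hsw c hc.1
      exact ⟨(hsw c hc.1).1, by omega⟩
    · intro c _; simp
    · intro c _; simp
    · intro c hc
      rw [Finset.mem_filter, hmem] at hc
      rw [hook_swap h hc.1.1, Prod.swap_swap]
  rw [e2, ← Finset.prod_mul_distrib]
  apply Finset.prod_congr rfl
  intro c hc
  rw [Finset.mem_filter] at hc
  have h3 := (hsw c hc.1).2
  have h4 : c.1 ≠ c.2 := by
    intro h5
    have : c.swap = c := Prod.ext h5.symm h5
    rw [this] at h3
    omega
  have h5 : eps c * eps c.swap = -1 := by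
    unfold eps
    simp only [Prod.fst_swap, Prod.snd_swap]
    rcases lt_or_gt_of_ne h4 with h6 | h6
    · rw [if_neg (by omega), if_pos h6]; ring
    · rw [if_pos h6, if_neg (by omega)]; ring
  rw [div_mul_div_comm, mul_mul_mul_comm (hookLen μ c : ℂ), h5, div_pow, mul_neg_one, div_neg]
  ring

theorem exp_genfun_SC_even (t' : ℕ) (ht' : 0 < t') (b : ℂ) :
    ∑' μ : {μ : YoungDiagram // μ.transpose = μ},
      PowerSeries.C (R := ℂ) ((-1) ^ durfee μ.1 *
        ∏ c ∈ μ.1.cells.filter (fun c => (2 * t') ∣ hookLen μ.1 c),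
          (b * (2 * t' : ℕ) / ((hookLen μ.1 c : ℂ) * eps c))) * X ^ μ.1.card
      =
    pexp (- (PowerSeries.C (R := ℂ) (b ^ 2 * (t' : ℂ)) * X ^ (2 * (2 * t')))) *
      ∏' k : ℕ,
        ((1 - X ^ (k + 1)) * (1 - X ^ (2 * (k + 1)) : PowerSeries ℂ)⁻¹ *
          (1 - X ^ (2 * (k + 1) * (2 * t'))) ^ t') := by
  rw [← core t' ht' b, ← scE.tsum_eq]
  apply tsum_congr
  intro μ
  have h1 : scE μ = PP μ.1 := rfl
  rw [h1, card_PP, card_sc μ.2, prod_hooks μ.2 t' ht' b]
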